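/- Let p > 5 be a real number. Then there exist smooth even functions M̃, Ẽ_tt, Ẽ_rr : Γ₁ → ℝ and a smooth odd function Ẽ_tr : Γ₁ → ℝ, with M̃ homogeneous of order (2p−6)/(p−1) and Ẽ_tt, Ẽ_tr, Ẽ_rr homogeneous of order −4/(p−1), with M̃ and Ẽ_tt vanishing to second order at r = 0, Ẽ_tr − (1/(2r))∂_t M̃ vanishing to third order at r = 0, and Ẽ_rr − (1/r)∂_r M̃ + (1/r²)M̃ vanishing to fourth order at r = 0, such that, defining V := (1/(p+1))[(1/2)(−∂_tt M̃ + ∂_rr M̃) + Ẽ_tt − Ẽ_rr] and e₊ := (1/2)Ẽ_tt + (1/2)Ẽ_rr + Ẽ_tr on Γ₁: (i) V ≥ 0 on Γ₁; (ii) (∂_t − ∂_r)e₊ + (∂_t + ∂_r)V = −((p−1)/r)V for all (t,r) ∈ Γ₁ with r ≠ 0; (iii) the 3×3 matrix [[M̃, (1/2)∂_t M̃, (1/2)∂_r M̃], [(1/2)∂_t M̃, Ẽ_tt, Ẽ_tr], [(1/2)∂_r M̃, Ẽ_tr, Ẽ_rr]] is strictly positive definite at every point of Γ₁ with r ≠ 0;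 and (iv) ∂_rr Ẽ_tt(1,0) > (2/(p−1))² ∂_rr M̃(1,0) > 0. -/

import Mathlib

open Real MeasureTheory

noncomputable section

/-- The `1+1`-dimensional light cone `Γ₁ = {(t,r) : t > 0, -t ≤ r ≤ t}`. -/
def Cone1 : Set (ℝ × ℝ) := {q | 0 < q.1 ∧ |q.2| ≤ q.1}

/-- The partial derivative `∂_t` on `ℝ × ℝ`. -/
def pdt (f : ℝ × ℝ → ℝ) : ℝ × ℝ → ℝ := fun q => fderiv ℝ f q (1, 0)

/-- The partial derivative `∂_r` on `ℝ × ℝ`. -/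
def pdr (f : ℝ × ℝ → ℝ) : ℝ × ℝ → ℝ := fun q => fderiv ℝ f q (0, 1)

/-- `f` is even in `r` on `Γ₁`. -/
def IsEvenR (f : ℝ × ℝ → ℝ) : Prop := ∀ q ∈ Cone1, f (q.1, -q.2) = f q

/-- `f` is odd in `r` on `Γ₁`. -/
def IsOddR (f : ℝ × ℝ → ℝ) : Prop := ∀ q ∈ Cone1, f (q.1, -q.2) = -f q

/-- `f` is homogeneous of order `α` on `Γ₁`. -/
def HomogOrder (α : ℝ) (f : ℝ × ℝ → ℝ) : Prop :=
  ∀ l : ℝ, 0 < l → ∀ q ∈ Cone1, f (l • q) = l ^ α * f q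

/-- `g` vanishes to `k`-th order at `r = 0`: `g, ∂_r g, …, ∂_r^{k-1} g` all vanish at
`(t, 0)` for every `t > 0`. -/
def VanishOrder (k : ℕ) (g : ℝ × ℝ → ℝ) : Prop :=
  ∀ t : ℝ, 0 < t → ∀ j < k, (pdr^[j] g) (t, 0) = 0

/-- `f` is smooth on `Γ₁`: it is smooth on some open neighbourhood of `Γ₁`. -/
def SmoothOnCone1 (f : ℝ × ℝ → ℝ) : Prop :=
  ∃ Ω : Set (ℝ × ℝ), IsOpen Ω ∧ Cone1 ⊆ Ω ∧ ContDiffOn ℝ (⊤ : ℕ∞) f Ω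

/-- The `3×3` matrix of (iii). -/
def mat3 (M Ett Err Etr : ℝ × ℝ → ℝ) (q : ℝ × ℝ) : Matrix (Fin 3) (Fin 3) ℝ :=
  !![M q, (1 / 2) * pdt M q, (1 / 2) * pdr M q;
     (1 / 2) * pdt M q, Ett q, Etr q;
     (1 / 2) * pdr M q, Etr q, Err q]

/-- The extension of a profile `f` to a homogeneous function of order `α` on `t > 0`. -/
def homExt (α : ℝ) (f : ℝ → ℝ) : ℝ × ℝ → ℝ := fun q => q.1 ^ α * f (q.2 / q.1)

lemma differentiableAt_homExt {α : ℝ} {f : ℝ → ℝ} (hf : Differentiable ℝ f) {q : ℝ × ℝ}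
    (hq : 0 < q.1) : DifferentiableAt ℝ (homExt α f) q := by
  unfold homExt
  refine DifferentiableAt.mul ?_ ?_
  · exact differentiableAt_fst.rpow_const (Or.inl hq.ne')
  · have h : DifferentiableAt ℝ (fun q : ℝ × ℝ => q.2 / q.1) q := by
      simp only [div_eq_mul_inv]
      exact differentiableAt_snd.mul (differentiableAt_fst.inv hq.ne')
    exact (hf _).comp q h

lemma pdt_homExt {α : ℝ} {f : ℝ → ℝ} (hf : Differentiable ℝ f) {q : ℝ × ℝ} (hq : 0 < q.1) :
    pdt (homExt α f) q = homExt (α - 1) (fun x => α * f x - x * deriv f x) q := by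
  obtain ⟨t, r⟩ := q
  simp only at hq
  have h1 : HasDerivAt (fun s : ℝ => (s, r)) ((1 : ℝ), (0 : ℝ)) t :=
    (hasDerivAt_id t).prodMk (hasDerivAt_const t r)
  have h2 := (differentiableAt_homExt (α := α) hf (q := (t, r)) hq).hasFDerivAt.comp_hasDerivAt t h1
  have h3 : HasDerivAt (fun s : ℝ => s ^ α * f (r / s))
      (α * t ^ (α - 1) * f (r / t) + t ^ α * (deriv f (r / t) * (-r / t ^ 2))) t := by
    have hd : HasDerivAt (fun s : ℝ => r / s) (-r / t ^ 2) t := by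
      have h := (hasDerivAt_const t r).fun_div (hasDerivAt_id' t) hq.ne'
      simpa using h
    exact (Real.hasDerivAt_rpow_const (Or.inl hq.ne')).mul
      ((hf (r / t)).hasDerivAt.comp t hd)
  have h4 := h2.unique h3
  unfold pdt
  rw [h4]
  simp only [homExt, Real.rpow_sub_one hq.ne']
  field_simp
  ring

lemma pdr_homExt {α : ℝ} {f : ℝ → ℝ} (hf : Differentiable ℝ f) {q : ℝ × ℝ} (hq : 0 < q.1) :
    pdr (homExt α f) q = homExt (α - 1) (deriv f) q := by
  obtain ⟨t, r⟩ := q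
  simp only at hq
  have h1 : HasDerivAt (fun s : ℝ => (t, s)) ((0 : ℝ), (1 : ℝ)) r :=
    (hasDerivAt_const r t).prodMk (hasDerivAt_id r)
  have h2 := (differentiableAt_homExt (α := α) hf (q := (t, r)) hq).hasFDerivAt.comp_hasDerivAt r h1
  have h3 : HasDerivAt (fun s : ℝ => t ^ α * f (s / t)) (t ^ α * (deriv f (r / t) * (1 / t))) r :=
    ((hf (r / t)).hasDerivAt.comp r ((hasDerivAt_id r).div_const t)).const_mul _
  have h4 := h2.unique h3
  unfold pdr
  rw [h4]
  simp only [homExt, Real.rpow_sub_one hq.ne']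
  field_simp

lemma fderiv_congr_of_pos {F G : ℝ × ℝ → ℝ} (h : ∀ q : ℝ × ℝ, 0 < q.1 → F q = G q)
    {q : ℝ × ℝ} (hq : 0 < q.1) : fderiv ℝ F q = fderiv ℝ G q := by
  apply Filter.EventuallyEq.fderiv_eq
  filter_upwards [(isOpen_lt continuous_const continuous_fst).mem_nhds hq] with a ha using h a ha

lemma pdt_congr {F G : ℝ × ℝ → ℝ} (h : ∀ q : ℝ × ℝ, 0 < q.1 → F q = G q)
    {q : ℝ × ℝ} (hq : 0 < q.1) : pdt F q = pdt G q := by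
  simp only [pdt, fderiv_congr_of_pos h hq]

lemma pdr_congr {F G : ℝ × ℝ → ℝ} (h : ∀ q : ℝ × ℝ, 0 < q.1 → F q = G q)
    {q : ℝ × ℝ} (hq : 0 < q.1) : pdr F q = pdr G q := by
  simp only [pdr, fderiv_congr_of_pos h hq]

lemma ContDiff.deriv_top {f : ℝ → ℝ} (hf : ContDiff ℝ (⊤ : ℕ∞) f) :
    ContDiff ℝ (⊤ : ℕ∞) (deriv f) :=
  (contDiff_infty_iff_deriv.1 hf).2

lemma ContDiff.differentiable_top {f : ℝ → ℝ} (hf : ContDiff ℝ (⊤ : ℕ∞) f) :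
    Differentiable ℝ f :=
  (contDiff_infty_iff_deriv.1 hf).1

lemma iterate_pdr_homExt (j : ℕ) : ∀ {α : ℝ} {f : ℝ → ℝ} {F : ℝ × ℝ → ℝ},
    ContDiff ℝ (⊤ : ℕ∞) f → (∀ q : ℝ × ℝ, 0 < q.1 → F q = homExt α f q) →
    ∀ q : ℝ × ℝ, 0 < q.1 → (pdr^[j] F) q = homExt (α - j) (deriv^[j] f) q := by
  induction j with
  | zero => intro α f F _ h q hq; simpa using h q hq
  | succ j ih =>
    intro α f F hf h q hq
    rw [Function.iterate_succ_apply, Function.iterate_succ_apply,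
      ih (α := α - 1) hf.deriv_top
        (fun a ha => (pdr_congr h ha).trans (pdr_homExt hf.differentiable_top ha)) q hq]
    push_cast
    ring_nf

lemma iterate_deriv_pow_mul (j : ℕ) : ∀ {k : ℕ} {ρ : ℝ → ℝ}, ContDiff ℝ (⊤ : ℕ∞) ρ → j < k →
    (deriv^[j] (fun x => x ^ k * ρ x)) 0 = 0 := by
  induction j with
  | zero => intro k ρ _ hk; simp [show k ≠ 0 by omega]
  | succ j ih =>
    intro k ρ hρ hk
    obtain ⟨k, rfl⟩ : ∃ l, k = l + 1 := ⟨k - 1, by omega⟩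
    have : deriv (fun x => x ^ (k + 1) * ρ x)
        = fun x => x ^ k * ((k + 1) * ρ x + x * deriv ρ x) := by
      funext x
      have := ((hasDerivAt_pow (k + 1) x).mul (hρ.differentiable_top x).hasDerivAt).deriv
      refine this.trans ?_
      push_cast
      ring
    rw [Function.iterate_succ_apply, this]
    refine ih ?_ (by omega)
    have := hρ.deriv_top
    fun_prop

lemma vanishOrder_of_eq {k : ℕ} {α : ℝ} {ρ : ℝ → ℝ} {F : ℝ × ℝ → ℝ}
    (hρ : ContDiff ℝ (⊤ : ℕ∞) ρ)
    (h : ∀ q : ℝ × ℝ, 0 < q.1 → F q = homExt α (fun x => x ^ k * ρ x) q) : VanishOrder k F := by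
  intro t ht j hj
  rw [iterate_pdr_homExt j (by fun_prop) h _ ht]
  simp only [homExt, zero_div]
  rw [iterate_deriv_pow_mul j hρ hj, mul_zero]

lemma smoothOnCone1_homExt {α : ℝ} {f : ℝ → ℝ} (hf : ContDiff ℝ (⊤ : ℕ∞) f) :
    SmoothOnCone1 (homExt α f) := by
  refine ⟨{q | 0 < q.1}, isOpen_lt continuous_const continuous_fst, fun q hq => hq.1, ?_⟩
  intro q hq
  have hq' : q.1 ≠ 0 := ne_of_gt hq
  apply ContDiffAt.contDiffWithinAt
  unfold homExt
  refine ContDiffAt.mul ?_ ?_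
  · exact contDiffAt_fst.rpow_const_of_ne hq'
  · exact hf.contDiffAt.comp q (contDiffAt_snd.div contDiffAt_fst hq')

lemma homogOrder_homExt (α : ℝ) (f : ℝ → ℝ) : HomogOrder α (homExt α f) := by
  intro l hl q hq
  simp only [homExt, Prod.smul_fst, Prod.smul_snd, smul_eq_mul]
  rw [Real.mul_rpow hl.le hq.1.le, mul_div_mul_left _ _ hl.ne']
  ring

lemma isEvenR_homExt {α : ℝ} {f : ℝ → ℝ} (hf : ∀ x, f (-x) = f x) : IsEvenR (homExt α f) := by
  intro q _
  simp [homExt, neg_div, hf]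

lemma isOddR_homExt {α : ℝ} {f : ℝ → ℝ} (hf : ∀ x, f (-x) = -f x) : IsOddR (homExt α f) := by
  intro q _
  simp [homExt, neg_div, hf]

/-- The coefficient of `x ^ (2 * i + 1)` in the odd solution of the one-dimensional wave equation
that is homogeneous of order `1 - q` and has unit slope at `x = 0`. -/
def oddCoeff (q : ℝ) : ℕ → ℝ
  | 0 => 1
  | i + 1 => oddCoeff q i * ((2 * i + 1 + q) * (2 * i + q)) / ((2 * i + 2) * (2 * i + 3))

lemma oddCoeff_pos {q : ℝ} (hq : 0 < q) (i : ℕ) : 0 < oddCoeff q i := by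
  induction i with
  | zero => simp [oddCoeff]
  | succ i ih => rw [oddCoeff]; positivity

lemma oddCoeff_succ (q : ℝ) (i : ℕ) :
    oddCoeff q (i + 1) * ((2 * i + 2) * (2 * i + 3))
      = oddCoeff q i * ((2 * i + 1 + q) * (2 * i + q)) := by
  rw [oddCoeff]
  field_simp

lemma exists_mul_oddCoeff_lt {q : ℝ} (hq : 0 < q) (hq1 : q < 1) {ε : ℝ} (hε : 0 < ε) (n₀ : ℕ) :
    ∃ j : ℕ, n₀ ≤ j ∧ j * oddCoeff q j < ε := by
  obtain ⟨n₁, hn₁⟩ := exists_nat_gt (4 / (1 - q))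
  have h1q : 0 < 1 - q := by linarith
  set θ := (1 - q) / 4 with hθ
  have hθ0 : 0 < θ := by positivity
  let n := max (max n₀ n₁) 1
  have hn1 : 1 ≤ n := le_max_right _ _
  have hnn : (4 / (1 - q)) < n := lt_of_lt_of_le hn₁ (by
    exact_mod_cast (le_max_right n₀ n₁).trans (le_max_left _ _))
  let H : ℕ → ℝ := fun m => ∑ i ∈ Finset.range m, 1 / ((i : ℝ) + 1)
  have hH0 : ∀ m, 0 ≤ H m := fun m => Finset.sum_nonneg fun i _ => by positivity
  have key : ∀ m, n ≤ m → m * oddCoeff q m * (1 + θ * H m)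
      ≤ n * oddCoeff q n * (1 + θ * H n) := by
    intro m hm
    induction m, hm using Nat.le_induction with
    | base => exact le_rfl
    | succ m hm ih =>
      refine le_trans ?_ ih
      have hm0 : (0 : ℝ) < m := by exact_mod_cast (by omega : 0 < m)
      have hm1 : (1 : ℝ) ≤ m := by exact_mod_cast (by omega : 1 ≤ m)
      have hmq : 4 < (1 - q) * m := by
        have : 4 / (1 - q) < m := hnn.trans_le (by exact_mod_cast hm)
        rw [div_lt_iff₀ h1q] at this; linarith
      have hHs : H (m + 1) = H m + 1 / ((m : ℝ) + 1) := Finset.sum_range_succ _ _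
      rw [hHs, oddCoeff]
      have hc := oddCoeff_pos hq m
      have h2 : ((m + 1 : ℕ) : ℝ) * (oddCoeff q m * ((2 * m + 1 + q) * (2 * m + q))
          / ((2 * m + 2) * (2 * m + 3)))
          = m * oddCoeff q m * (((2 * m + 1 + q) * (2 * m + q)) / (2 * m * (2 * m + 3))) := by
        push_cast; field_simp
      rw [h2, mul_assoc]
      refine mul_le_mul_of_nonneg_left ?_ (by positivity)
      have h3 : 1 + θ * (H m + 1 / ((m : ℝ) + 1)) ≤ (1 + θ * H m) * ((m + 1 + θ) / (m + 1)) := by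
        have : (1 + θ * H m) * ((m + 1 + θ) / (m + 1))
            = 1 + θ * (H m + 1 / ((m : ℝ) + 1)) + θ * H m * (θ / (m + 1)) := by
          field_simp; ring
        have h4 : 0 ≤ θ * H m * (θ / (m + 1)) := by have := hH0 m; positivity
        linarith
      have h5 : ((2 * m + 1 + q) * (2 * m + q)) / (2 * m * (2 * m + 3)) * ((m + 1 + θ) / (m + 1))
          ≤ 1 := by
        rw [div_mul_div_comm, div_le_one (by positivity), hθ]
        have h6 : (q + q ^ 2) * (m + 1 + (1 - q) / 4) ≤ 2 * (m + 5 / 4) :=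
          mul_le_mul (by nlinarith) (by linarith) (by positivity) (by norm_num)
        have h7 : 4 * (m : ℝ) < (1 - q) * m * m := by gcongr
        have h8 : 0 < (1 - q) * m := by positivity
        have h9 : 0 < (1 - q) * ((1 - q) * m) := by positivity
        nlinarith
      calc _ ≤ ((2 * m + 1 + q) * (2 * m + q)) / (2 * m * (2 * m + 3))
            * ((1 + θ * H m) * ((m + 1 + θ) / (m + 1))) :=
            mul_le_mul_of_nonneg_left h3 (by positivity)
        _ = (1 + θ * H m) * (((2 * m + 1 + q) * (2 * m + q)) / (2 * m * (2 * m + 3))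
            * ((m + 1 + θ) / (m + 1))) := by ring
        _ ≤ (1 + θ * H m) * 1 := mul_le_mul_of_nonneg_left h5 (by have := hH0 m; positivity)
        _ = _ := mul_one _
  have hlim : Filter.Tendsto H Filter.atTop Filter.atTop :=
    Real.tendsto_sum_range_one_div_nat_succ_atTop
  obtain ⟨j, hj, hjn⟩ := ((hlim.eventually_gt_atTop
    (n * oddCoeff q n * (1 + θ * H n) / ε / θ)).and (Filter.eventually_ge_atTop n)).exists
  refine ⟨j, ((le_max_left n₀ n₁).trans (le_max_left _ _)).trans hjn, ?_⟩
  rw [div_div, div_lt_iff₀ (by positivity)] at hj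
  have h := key j hjn
  by_contra! hcon
  have : ε * (1 + θ * H j) ≤ j * oddCoeff q j * (1 + θ * H j) :=
    mul_le_mul_of_nonneg_right hcon (by have := hH0 j; positivity)
  nlinarith

/-- The energy density profile. -/
def profE (q : ℝ) (e : ℝ → ℝ) (x : ℝ) : ℝ := 1 + q * (1 + q) / 2 * x ^ 2 + x ^ 4 * e x

/-- The momentum density profile. -/
def profT (q : ℝ) (τ : ℝ → ℝ) (x : ℝ) : ℝ := -q * x + x ^ 3 * τ x

/-- The potential energy profile. -/
def profV (w : ℝ → ℝ) (x : ℝ) : ℝ := x ^ 4 * w x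

/-- Profiles solving the energy and momentum transport equations, with `p = 1 + 4 / q`, and
satisfying the strict Gram inequality on `[-1, 1]`. -/
structure IsProfile (q : ℝ) (e τ w : ℝ → ℝ) : Prop where
  smooth_e : ContDiff ℝ (⊤ : ℕ∞) e
  smooth_t : ContDiff ℝ (⊤ : ℕ∞) τ
  smooth_w : ContDiff ℝ (⊤ : ℕ∞) w
  even_e : ∀ x, e (-x) = e x
  even_t : ∀ x, τ (-x) = τ x
  even_w : ∀ x, w (-x) = w x
  energy : ∀ x, -q * (profE q e x + profV w x) - x * (deriv (profE q e) x + deriv (profV w) x)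
    - deriv (profT q τ) x = 0
  momentum : ∀ x, x * (-q * profT q τ x - x * deriv (profT q τ) x - deriv (profE q e) x
    + deriv (profV w) x) = -(4 / q) * profV w x
  w_nonneg : ∀ x, |x| ≤ 1 → 0 ≤ w x
  e_pos : ∀ x, |x| ≤ 1 → 0 < profE q e x
  gram : ∀ x, |x| ≤ 1 → ((2 + q) / q * profV w x) ^ 2 + profT q τ x ^ 2 < profE q e x ^ 2

/-- Partial sums of the energy profile of the free wave. -/
def eSum (q : ℝ) (n : ℕ) (x : ℝ) : ℝ :=
  ∑ i ∈ Finset.range n, oddCoeff q i * (2 * i + 1) * x ^ (2 * i)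

/-- Partial sums of the momentum profile of the free wave. -/
def tSum (q : ℝ) (n : ℕ) (x : ℝ) : ℝ :=
  ∑ i ∈ Finset.range n, -(oddCoeff q i * (2 * i + q)) * x ^ (2 * i + 1)

lemma mul_deriv_pow (n : ℕ) (x : ℝ) : x * ((n : ℝ) * x ^ (n - 1)) = n * x ^ n := by
  cases n with
  | zero => simp
  | succ n => simp only [Nat.add_sub_cancel]; ring

lemma hasDerivAt_sums (q : ℝ) (n : ℕ) (x : ℝ) : ∃ a b, HasDerivAt (eSum q n) a x ∧
    HasDerivAt (tSum q n) b x ∧ -q * eSum q n x - x * a - b = 0 ∧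
    x * (-q * tSum q n x - x * b - a) = oddCoeff q n * (2 * n) * (2 * n + 1) * x ^ (2 * n) := by
  induction n with
  | zero =>
    refine ⟨0, 0, ?_, ?_, ?_, ?_⟩
    · exact hasDerivAt_const x (0 : ℝ)
    · exact hasDerivAt_const x (0 : ℝ)
    · simp [eSum]
    · simp [tSum]
  | succ n ih =>
    obtain ⟨a, b, ha, hb, h1, h2⟩ := ih
    have he : eSum q (n + 1) = fun y => eSum q n y + oddCoeff q n * (2 * n + 1) * y ^ (2 * n) := by
      funext y; exact Finset.sum_range_succ _ _
    have ht : tSum q (n + 1)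
        = fun y => tSum q n y + -(oddCoeff q n * (2 * n + q)) * y ^ (2 * n + 1) := by
      funext y; exact Finset.sum_range_succ _ _
    rw [he, ht]
    refine ⟨_, _, ha.fun_add ((hasDerivAt_pow (2 * n) x).const_mul _),
      hb.fun_add ((hasDerivAt_pow (2 * n + 1) x).const_mul _), ?_, ?_⟩
    · have h3 := mul_deriv_pow (2 * n) x
      simp only [Nat.add_sub_cancel]
      push_cast at h3 ⊢
      linear_combination h1 - oddCoeff q n * (2 * n + 1) * h3
    · have h3 := mul_deriv_pow (2 * n) x
      have h4 := oddCoeff_succ q n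
      simp only [Nat.add_sub_cancel]
      push_cast at h3 ⊢
      linear_combination h2 - oddCoeff q n * (2 * n + 1) * h3 - x ^ (2 * n + 2) * h4

lemma one_le_eSum_sub_tSum {q : ℝ} (hq : 0 < q) {x : ℝ} (hx : 0 ≤ x) (n : ℕ) :
    1 ≤ eSum q (n + 1) x - tSum q (n + 1) x := by
  induction n with
  | zero => simp [eSum, tSum, oddCoeff]; positivity
  | succ n ih =>
    rw [eSum, tSum, Finset.sum_range_succ _ (n + 1), Finset.sum_range_succ _ (n + 1)]
    rw [eSum, tSum] at ih
    have := oddCoeff_pos hq (n + 1)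
    have h1 : 0 ≤ oddCoeff q (n + 1) * (2 * (n + 1 : ℕ) + 1) * x ^ (2 * (n + 1)) := by positivity
    have h2 : 0 ≤ oddCoeff q (n + 1) * (2 * (n + 1 : ℕ) + q) * x ^ (2 * (n + 1) + 1) := by
      positivity
    linarith

lemma le_eSum_add_tSum {q : ℝ} (hq : 0 < q) (hq1 : q < 1) {x : ℝ} (hx : 0 ≤ x) (hx1 : x ≤ 1)
    (n : ℕ) : 1 - q ≤ eSum q (n + 1) x + tSum q (n + 1) x := by
  induction n with
  | zero => simp [eSum, tSum, oddCoeff]; nlinarith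
  | succ n ih =>
    rw [eSum, tSum, Finset.sum_range_succ _ (n + 1), Finset.sum_range_succ _ (n + 1)]
    rw [eSum, tSum] at ih
    have h0 := oddCoeff_pos hq (n + 1)
    have h1 : 0 ≤ oddCoeff q (n + 1) * x ^ (2 * (n + 1))
        * ((2 * (n + 1 : ℕ) + 1) - (2 * (n + 1 : ℕ) + q) * x) := by
      refine mul_nonneg (by positivity) ?_
      have : (2 * ((n + 1 : ℕ) : ℝ) + q) * x ≤ (2 * ((n + 1 : ℕ) : ℝ) + q) * 1 := by gcongr
      linarith
    have h2 : oddCoeff q (n + 1) * (2 * (n + 1 : ℕ) + 1) * x ^ (2 * (n + 1))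
        + -(oddCoeff q (n + 1) * (2 * (n + 1 : ℕ) + q)) * x ^ (2 * (n + 1) + 1)
        = oddCoeff q (n + 1) * x ^ (2 * (n + 1))
        * ((2 * (n + 1 : ℕ) + 1) - (2 * (n + 1 : ℕ) + q) * x) := by ring
    linarith

lemma pow_mul_one_sub_sq_le (j : ℕ) {x : ℝ} :
    (x ^ 2) ^ j * (1 - x ^ 2) * (j + 1) ≤ 1 := by
  rcases le_total (x ^ 2) 1 with h | h
  · have hg := mul_neg_geom_sum (x ^ 2) (j + 1)
    have h1 : (j + 1 : ℝ) * (x ^ 2) ^ j ≤ ∑ i ∈ Finset.range (j + 1), (x ^ 2) ^ i := by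
      have := Finset.card_nsmul_le_sum (Finset.range (j + 1)) (fun i => (x ^ 2) ^ i) ((x ^ 2) ^ j)
        (fun i hi => pow_le_pow_of_le_one (sq_nonneg x) h (by
          have := Finset.mem_range.1 hi; omega))
      simpa using this
    have h2 : 0 ≤ (x ^ 2) ^ (j + 1) := by positivity
    have h3 : (1 - x ^ 2) * ((j + 1 : ℝ) * (x ^ 2) ^ j) ≤ _ :=
      mul_le_mul_of_nonneg_left h1 (by linarith)
    rw [hg] at h3
    linarith
  · have : (x ^ 2) ^ j * (1 - x ^ 2) ≤ 0 :=
      mul_nonpos_of_nonneg_of_nonpos (by positivity) (by linarith)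
    nlinarith [(Nat.cast_nonneg j : (0 : ℝ) ≤ j)]

/-- The amplitudes of the top order term of the free wave profile and of the potential. -/
lemma exists_amplitudes {q : ℝ} (hq : 0 < q) (hq1 : q < 1) : ∃ (J : ℕ) (k D : ℝ),
    0 < k ∧ 0 < D ∧ 2 * D ≤ k * (2 * (J + 2) + q) ∧
    D * (4 * (J + 2) + 4 / q)
      = 2 * (J + 2) * (2 * (J + 2) + 1) * (k - oddCoeff q (J + 2)) ∧
    D * (4 * (J + 2) + 4 + 4 / q) = k * (2 * (J + 2) + q) * (2 * (J + 2) + 1 + q) ∧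
    (2 + q) / q * (D / (J + 2 + 1)) < 1 - q := by
  have h1q : 0 < 1 - q := by linarith
  obtain ⟨n₁, hn₁⟩ := exists_nat_gt (3 / (1 - q))
  obtain ⟨j, hj, hsmall⟩ := exists_mul_oddCoeff_lt hq hq1
    (ε := (1 - q) * q * (1 - q) / (9 * (2 + q))) (by positivity) (max n₁ 2)
  obtain ⟨J, rfl⟩ : ∃ J, j = J + 2 := ⟨j - 2, by have := (le_max_right n₁ 2).trans hj; omega⟩
  have hjq : 3 < (1 - q) * (J + 2 : ℝ) := by
    have h : (n₁ : ℝ) ≤ (J + 2 : ℕ) := by exact_mod_cast (le_max_left n₁ 2).trans hj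
    push_cast at h
    rw [div_lt_iff₀ h1q] at hn₁
    nlinarith
  have hc := oddCoeff_pos hq (J + 2)
  refine ⟨J, ?_⟩
  push_cast at hsmall
  have hj2 : (2 : ℝ) ≤ J + 2 := by linarith [(Nat.cast_nonneg J : (0 : ℝ) ≤ J)]
  generalize oddCoeff q (J + 2) = c at *
  generalize (J : ℝ) + 2 = j at *
  have hj0 : 0 < j := by linarith
  set Λ := 4 * j ^ 2 * (1 - q) - j * (2 + q + q ^ 2) - (1 + q) with hΛ
  have hΛ2 : 2 * j ^ 2 * (1 - q) ≤ Λ := by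
    have h3 : 3 * j < (1 - q) * j * j := by gcongr
    have h4 : j * (2 + q + q ^ 2) ≤ j * 4 := by gcongr; nlinarith
    nlinarith
  have hΛ0 : 0 < Λ := lt_of_lt_of_le (by positivity) hΛ2
  refine ⟨2 * j * (2 * j + 1) * (q * j + q + 1) * c / (q * Λ),
    j * (2 * j + 1) * (2 * j + q) * (2 * j + 1 + q) * c / (2 * Λ), by positivity, by positivity,
    ?_, ?_, ?_, ?_⟩
  · have h : 2 * j * (2 * j + 1) * (q * j + q + 1) * c / (q * Λ) * (2 * j + q)
        - 2 * (j * (2 * j + 1) * (2 * j + q) * (2 * j + 1 + q) * c / (2 * Λ))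
        = j * (2 * j + 1) * (2 * j + q) * c / (q * Λ) * (q + (2 - q ^ 2)) := by
      field_simp; ring
    have h5 : 0 ≤ j * (2 * j + 1) * (2 * j + q) * c / (q * Λ) * (q + (2 - q ^ 2)) := by
      have : 0 ≤ q + (2 - q ^ 2) := by nlinarith
      positivity
    linarith
  · field_simp
    rw [hΛ]; ring
  · field_simp
    ring
  · have hD : j * (2 * j + 1) * (2 * j + q) * (2 * j + 1 + q) * c / (2 * Λ) / (j + 1)
        ≤ 9 * (j * c) / (1 - q) := by
      rw [div_div, div_le_div_iff₀ (by positivity) h1q]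
      have a1 : j * (2 * j + 1) * (2 * j + q) * (2 * j + 1 + q) * c * (1 - q)
          ≤ j * (3 * j) * (3 * j) * (4 * j) * c * (1 - q) := by
        gcongr <;> linarith
      have a2 : 9 * (j * c) * (2 * (2 * j ^ 2 * (1 - q)) * j) ≤ 9 * (j * c) * (2 * Λ * (j + 1)) := by
        gcongr; linarith
      nlinarith
    calc _ ≤ (2 + q) / q * (9 * (j * c) / (1 - q)) := by gcongr
      _ < (2 + q) / q * (9 * ((1 - q) * q * (1 - q) / (9 * (2 + q))) / (1 - q)) := by gcongr
      _ = 1 - q := by field_simp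

lemma exists_isProfile {q : ℝ} (hq : 0 < q) (hq1 : q < 1) : ∃ e τ w, IsProfile q e τ w := by
  obtain ⟨J, k, D, hk, hD, hkD, hA, hB, hsmall⟩ := exists_amplitudes hq hq1
  let e : ℝ → ℝ := fun x => ∑ i ∈ Finset.range J, oddCoeff q (i + 2) * (2 * i + 5) * x ^ (2 * i)
    + k * (2 * J + 5) * x ^ (2 * J) - D * (x ^ (2 * J) - x ^ (2 * J + 2))
  let τ : ℝ → ℝ := fun x => -((2 + q) * oddCoeff q 1) + x ^ 2 *
    (∑ i ∈ Finset.range J, -(oddCoeff q (i + 2) * (2 * i + 4 + q)) * x ^ (2 * i)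
      - k * (2 * J + 4 + q) * x ^ (2 * J))
  let w : ℝ → ℝ := fun x => D * (x ^ (2 * J) - x ^ (2 * J + 2))
  have hV : ∀ x, profV w x = D * (x ^ (2 * (J + 2)) - x ^ (2 * (J + 2) + 2)) := by
    intro x; simp only [profV, w]; ring
  have hE : ∀ x, profE q e x = eSum q (J + 2) x + (2 * (J + 2) + 1) * k * x ^ (2 * (J + 2))
      - profV w x := by
    intro x
    rw [hV, eSum, Finset.sum_range_succ', Finset.sum_range_succ']
    have : ∑ i ∈ Finset.range J, oddCoeff q (i + 1 + 1) * (2 * ((i + 1 + 1 : ℕ) : ℝ) + 1)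
        * x ^ (2 * (i + 1 + 1)) = x ^ 4 * ∑ i ∈ Finset.range J,
          oddCoeff q (i + 2) * (2 * i + 5) * x ^ (2 * i) := by
      rw [Finset.mul_sum]
      refine Finset.sum_congr rfl fun i _ => ?_
      push_cast; ring
    rw [this]
    simp only [profE, e, oddCoeff]
    push_cast
    ring
  have hT : ∀ x, profT q τ x = tSum q (J + 2) x - (2 * (J + 2) + q) * k * x ^ (2 * (J + 2) + 1) := by
    intro x
    rw [tSum, Finset.sum_range_succ', Finset.sum_range_succ']
    have : ∑ i ∈ Finset.range J, -(oddCoeff q (i + 1 + 1) * (2 * ((i + 1 + 1 : ℕ) : ℝ) + q))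
        * x ^ (2 * (i + 1 + 1) + 1) = x ^ 5 * ∑ i ∈ Finset.range J,
          -(oddCoeff q (i + 2) * (2 * i + 4 + q)) * x ^ (2 * i) := by
      rw [Finset.mul_sum]
      refine Finset.sum_congr rfl fun i _ => ?_
      push_cast; ring
    rw [this]
    simp only [profT, τ, oddCoeff]
    push_cast
    ring
  have hVd : ∀ x, HasDerivAt (profV w) (D * (((2 * (J + 2) : ℕ) : ℝ) * x ^ (2 * (J + 2) - 1)
      - ((2 * (J + 2) + 2 : ℕ) : ℝ) * x ^ (2 * (J + 2) + 2 - 1))) x := by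
    intro x
    rw [funext hV]
    exact ((hasDerivAt_pow _ x).fun_sub (hasDerivAt_pow _ x)).const_mul D
  have hderiv : ∀ x, ∃ a b v', HasDerivAt (profE q e) a x ∧ HasDerivAt (profT q τ) b x ∧
      HasDerivAt (profV w) v' x ∧ -q * (profE q e x + profV w x) - x * (a + v') - b = 0 ∧
      x * (-q * profT q τ x - x * b - a + v') = -(4 / q) * profV w x := by
    intro x
    obtain ⟨a, b, ha, hb, h1, h2⟩ := hasDerivAt_sums q (J + 2) x
    have hE' := (ha.fun_add ((hasDerivAt_pow (2 * (J + 2)) x).const_mul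
      ((2 * (J + 2) + 1) * k))).fun_sub (hVd x)
    have hT' := hb.fun_sub ((hasDerivAt_pow (2 * (J + 2) + 1) x).const_mul ((2 * (J + 2) + q) * k))
    rw [← funext hE] at hE'
    rw [← funext hT] at hT'
    refine ⟨_, _, _, hE', hT', hVd x, ?_, ?_⟩
    · have h3 := mul_deriv_pow (2 * (J + 2)) x
      rw [hE]
      simp only [Nat.add_sub_cancel]
      push_cast at h3 ⊢
      linear_combination h1 - (2 * (J + 2) + 1) * k * h3
    · have h3 := mul_deriv_pow (2 * (J + 2)) x
      have h4 := mul_deriv_pow (2 * (J + 2) + 2) x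
      rw [hT, hV]
      simp only [Nat.add_sub_cancel]
      push_cast at h2 h3 h4 ⊢
      linear_combination h2 - (2 * (J + 2) + 1) * k * h3 + 2 * D * h3 - 2 * D * h4
        + x ^ (2 * (J + 2)) * hA - x ^ (2 * (J + 2) + 2) * hB
  have hwn : ∀ x, |x| ≤ 1 → 0 ≤ w x := by
    intro x hx
    have h1 : x ^ 2 ≤ 1 := by rw [← sq_abs]; exact pow_le_one₀ (abs_nonneg x) hx
    have h2 : w x = D * ((x ^ 2) ^ J * (1 - x ^ 2)) := by simp only [w]; ring
    rw [h2]
    have : 0 ≤ 1 - x ^ 2 := by linarith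
    positivity
  have hee : ∀ x, e (-x) = e x := fun x => by simp [e, pow_mul, pow_add]
  have hte : ∀ x, τ (-x) = τ x := fun x => by simp [τ, pow_mul]
  have hwe : ∀ x, w (-x) = w x := fun x => by simp [w, pow_mul, pow_add]
  have hpm : ∀ x, 0 ≤ x → x ≤ 1 → 1 - q ≤ profE q e x + profT q τ x ∧
      1 ≤ profE q e x - profT q τ x := by
    intro x hx hx1
    have h1 := one_le_eSum_sub_tSum hq hx (J + 1)
    have h2 := le_eSum_add_tSum hq hq1 hx hx1 (J + 1)
    have hp : 0 ≤ x ^ (2 * (J + 2)) := by positivity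
    have hJ : (0 : ℝ) ≤ J := Nat.cast_nonneg J
    have h3 : D * (1 - x ^ 2) ≤ k * ((2 * (J + 2) + 1) - (2 * (J + 2) + q) * x) := by
      have a1 : 2 * D * (1 - x) ≤ k * (2 * (J + 2) + q) * (1 - x) :=
        mul_le_mul_of_nonneg_right hkD (by linarith)
      have a2 : D * (1 - x) * (1 + x) ≤ D * (1 - x) * 2 :=
        mul_le_mul_of_nonneg_left (by linarith) (mul_nonneg hD.le (by linarith))
      nlinarith
    have h4 : 0 ≤ 2 * (k * ((2 * (J + 2) + q) * x)) := by positivity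
    have h5 := mul_nonneg hp (sub_nonneg.2 h3)
    have h6 := mul_nonneg hp h4
    rw [hE, hT, hV]
    constructor
    · linear_combination h2 + h5
    · linear_combination h1 + h5 + h6
  have hEe : ∀ x, profE q e (-x) = profE q e x := fun x => by
    simp [profE, hee, (by decide : Even 4).neg_pow]
  have hTo : ∀ x, profT q τ (-x) = -profT q τ x := fun x => by
    simp only [profT, hte]; ring
  have hpm' : ∀ x, |x| ≤ 1 → 0 < profE q e x ∧ 1 - q ≤ profE q e x ^ 2 - profT q τ x ^ 2 := by
    intro x hx
    obtain ⟨a1, a2⟩ := hpm |x| (abs_nonneg x) hx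
    have a3 : profE q e |x| = profE q e x ∧ profT q τ |x| ^ 2 = profT q τ x ^ 2 := by
      rcases abs_choice x with h | h <;> rw [h]
      · simp
      · simp [hEe, hTo]
    rw [← a3.1, ← a3.2]
    constructor
    · linarith
    · nlinarith
  refine ⟨e, τ, w, ?_, ?_, ?_, hee, hte, hwe, ?_, ?_, hwn, fun x hx => (hpm' x hx).1, ?_⟩
  · fun_prop
  · fun_prop
  · fun_prop
  · intro x
    obtain ⟨a, b, v', ha, hb, hv, h1, -⟩ := hderiv x
    rwa [ha.deriv, hb.deriv, hv.deriv]
  · intro x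
    obtain ⟨a, b, v', ha, hb, hv, -, h2⟩ := hderiv x
    rwa [ha.deriv, hb.deriv, hv.deriv]
  · intro x hx
    have h0 : 0 ≤ profV w x := mul_nonneg (by positivity) (hwn x hx)
    have h1 : profV w x ≤ D / (J + 2 + 1) := by
      rw [le_div_iff₀ (by positivity)]
      have h2 := pow_mul_one_sub_sq_le (J + 2) (x := x)
      push_cast at h2
      have h3 : profV w x = D * ((x ^ 2) ^ (J + 2) * (1 - x ^ 2)) := by rw [hV]; ring
      rw [h3]
      nlinarith
    have h2 : (2 + q) / q * profV w x < 1 - q := lt_of_le_of_lt (by gcongr) hsmall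
    have h3 : 0 ≤ (2 + q) / q * profV w x := by positivity
    have h4 := (hpm' x hx).2
    nlinarith

/-- The reduced time-time entry: what is left of it after projecting out the field direction, for
the mass profile `2 * x ^ 2 / (1 + κ * x ^ 2)`. -/
def redTT (q κ x E U : ℝ) : ℝ :=
  E + U - (1 - 3 * (κ * x ^ 2) * (1 - x ^ 2) + x ^ 2 * (((1 - q / 2) * (κ * x ^ 2) - q / 2) ^ 2
    - q / 2 * (1 + κ * x ^ 2) * (2 - (1 - q / 2) * (1 + κ * x ^ 2)))) / (1 + κ * x ^ 2) ^ 3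

/-- The reduced space-space entry. -/
def redRR (q κ x E U : ℝ) : ℝ :=
  E - U - (1 + 3 * (κ * x ^ 2) * (1 - x ^ 2) + x ^ 2 * (((1 - q / 2) * (κ * x ^ 2) - q / 2) ^ 2
    + q / 2 * (1 + κ * x ^ 2) * (2 - (1 - q / 2) * (1 + κ * x ^ 2)))) / (1 + κ * x ^ 2) ^ 3

/-- The reduced time-space entry. -/
def redTR (q κ x T : ℝ) : ℝ :=
  T - 2 * x * ((1 - q / 2) * (κ * x ^ 2) - q / 2) / (1 + κ * x ^ 2) ^ 3

lemma redTT_near_aux {q s z : ℝ} (hq : 0 < q) (hs : 0 < s) (hs1 : s ≤ 1)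
    (hz : 0 < z) : z * (1 + z) ^ 2 ≤ 6 * z + 3 * z ^ 2 + z ^ 3 - 3 * z * s
        + q * (1 + q) / 2 * s * (1 + z) ^ 3
        + s * (-(1 - q / 2) * z ^ 2 + q * z + q / 2) := by
  have a1 : z * s ≤ z * 1 := by gcongr
  have a2 : (1 - q / 2) * (z ^ 2 * s) ≤ 1 * (z ^ 2 * 1) := by gcongr; linarith
  have a3 : 0 ≤ q * (1 + q) / 2 * s * (1 + z) ^ 3 := by positivity
  have a4 : 0 ≤ s * (q * z + q / 2) := by positivity
  generalize q * (1 + q) / 2 * s * (1 + z) ^ 3 = A at *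
  linarith

lemma redRR_near_aux {q s z : ℝ} (hq : 0 < q) (hq1 : q < 1) (hs : 0 < s) (hs1 : s ≤ 1)
    (hz : 0 < z) : z ^ 2 * (1 + z) ≤ 3 * z ^ 2 + z ^ 3
          + q * (1 + q) / 2 * s * (3 * z + 3 * z ^ 2 + z ^ 3)
          + s * ((3 + q - q ^ 2) * z - (1 - q / 2) * (1 - q) * z ^ 2) := by
  have a2 : (1 - q / 2) * (1 - q) * (z ^ 2 * s) ≤ 1 * 1 * (z ^ 2 * 1) := by
    gcongr <;> linarith
  have a3 : 0 ≤ q * (1 + q) / 2 * s * (3 * z + 3 * z ^ 2 + z ^ 3) := by positivity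
  have a4 : 0 ≤ s * ((3 + q - q ^ 2) * z) := by
    have : 0 ≤ 3 + q - q ^ 2 := by nlinarith
    positivity
  have a5 : 0 < z ^ 2 := by positivity
  generalize q * (1 + q) / 2 * s * (3 * z + 3 * z ^ 2 + z ^ 3) = A at *
  linarith

lemma redTR_near_aux {q z : ℝ} (hq : 0 < q) (hq1 : q < 1) (hz : 0 < z) :
    q * (3 * z + 3 * z ^ 2 + z ^ 3) + 2 * (1 - q / 2) * z ≤ 5 * z * (1 + z) ^ 2 := by
  have a1 : q * (3 * z + 3 * z ^ 2 + z ^ 3) ≤ 1 * (3 * z + 3 * z ^ 2 + z ^ 3) := by gcongr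
  have a2 : 2 * (1 - q / 2) * z ≤ 2 * 1 * z := by gcongr; linarith
  have a3 := pow_pos hz 2
  have a4 := pow_pos hz 3
  linarith

lemma redTT_far_aux {q s z : ℝ} (hq : 0 < q) (hq1 : q < 1) (hs : 0 ≤ s) (hs1 : s ≤ 1)
    (hz : 0 ≤ z) : 1 - 3 * z * (1 - s) + s * (((1 - q / 2) * z - q / 2) ^ 2
      - q / 2 * (1 + z) * (2 - (1 - q / 2) * (1 + z))) ≤ 4 * (1 + z) ^ 2 := by
  have c0 : z * s ≤ z * 1 := by gcongr
  have c1 : (1 - q / 2) * (z ^ 2 * s) ≤ 1 * (z ^ 2 * 1) := by gcongr; linarith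
  have c2 : 0 ≤ q * (z * s) := by positivity
  have c3 : 0 ≤ q / 2 * s := by positivity
  have c4 := sq_nonneg z
  linarith

lemma redRR_far_aux {q s z : ℝ} (hq : 0 < q) (hq1 : q < 1) (hs : 0 ≤ s) (hs1 : s ≤ 1)
    (hz : 0 ≤ z) : 1 + 3 * z * (1 - s) + s * (((1 - q / 2) * z - q / 2) ^ 2
      + q / 2 * (1 + z) * (2 - (1 - q / 2) * (1 + z))) ≤ 4 * (1 + z) ^ 2 := by
  have c1 : (1 - q / 2) * (1 - q) * (z ^ 2 * s) ≤ 1 * 1 * (z ^ 2 * 1) := by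
    gcongr <;> linarith
  have c2 : 0 ≤ (3 + q - q ^ 2) * (z * s) := mul_nonneg (by nlinarith) (by positivity)
  have c3 : q * (1 + q) / 2 * s ≤ 1 * (1 + 1) / 2 * 1 := by gcongr
  have c4 := sq_nonneg z
  linarith

lemma redTR_far_aux {q x z : ℝ} (hq : 0 < q) (hq1 : q < 1) (hx : |x| ≤ 1) (hz : 0 ≤ z) :
    |2 * x * ((1 - q / 2) * z - q / 2)| ≤ 4 * (1 + z) ^ 2 := by
  have h : q * z ≤ 1 * z := by gcongr
  have h0 : 0 ≤ q * z := by positivity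
  have c1 : |(1 - q / 2) * z - q / 2| ≤ 1 + z := by
    rw [abs_le]; constructor <;> linarith
  rw [abs_mul, abs_mul]
  calc |2| * |x| * |(1 - q / 2) * z - q / 2| ≤ 2 * 1 * (1 + z) := by
        gcongr
        simp
    _ ≤ _ := by nlinarith

lemma le_redTT {q κ x C e U : ℝ} (hq : 0 < q) (hκ : 0 < κ) (hx : x ≠ 0)
    (hx1 : x ^ 2 ≤ 1) (he : -C ≤ e) (hU : 0 ≤ U) :
    κ * x ^ 2 / (1 + κ * x ^ 2) - C * x ^ 4
      ≤ redTT q κ x (1 + q * (1 + q) / 2 * x ^ 2 + x ^ 4 * e) U := by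
  have hx2 : 0 < x ^ 2 := by positivity
  set z := κ * x ^ 2 with hz
  have hz0 : 0 < z := by positivity
  have hy0 : 0 < 1 + z := by positivity
  have h1 : redTT q κ x (1 + q * (1 + q) / 2 * x ^ 2 + x ^ 4 * e) U = x ^ 4 * e + U +
      (6 * z + 3 * z ^ 2 + z ^ 3 - 3 * z * x ^ 2 + q * (1 + q) / 2 * x ^ 2 * (1 + z) ^ 3
        + x ^ 2 * (-(1 - q / 2) * z ^ 2 + q * z + q / 2)) / (1 + z) ^ 3 := by
    rw [redTT, ← hz]
    field_simp
    ring
  have h2 : z / (1 + z) ≤ (6 * z + 3 * z ^ 2 + z ^ 3 - 3 * z * x ^ 2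
      + q * (1 + q) / 2 * x ^ 2 * (1 + z) ^ 3
      + x ^ 2 * (-(1 - q / 2) * z ^ 2 + q * z + q / 2)) / (1 + z) ^ 3 := by
    rw [div_le_div_iff₀ hy0 (by positivity)]
    have a5 := redTT_near_aux hq hx2 hx1 hz0
    calc z * (1 + z) ^ 3 = z * (1 + z) ^ 2 * (1 + z) := by ring
      _ ≤ _ := by gcongr
  rw [h1]
  have h3 : x ^ 4 * (-C) ≤ x ^ 4 * e := by gcongr
  linarith

lemma le_redRR {q κ x C e U : ℝ} (hq : 0 < q) (hq1 : q < 1) (hκ : 0 < κ) (hx : x ≠ 0)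
    (hx1 : x ^ 2 ≤ 1) (he : -C ≤ e) (hUC : U ≤ C * x ^ 4) :
    (κ * x ^ 2 / (1 + κ * x ^ 2)) ^ 2 - 2 * C * x ^ 4
      ≤ redRR q κ x (1 + q * (1 + q) / 2 * x ^ 2 + x ^ 4 * e) U := by
  have hx2 : 0 < x ^ 2 := by positivity
  set z := κ * x ^ 2 with hz
  have hz0 : 0 < z := by positivity
  have hy0 : 0 < 1 + z := by positivity
  have h1 : redRR q κ x (1 + q * (1 + q) / 2 * x ^ 2 + x ^ 4 * e) U = x ^ 4 * e - U +
      (3 * z ^ 2 + z ^ 3 + q * (1 + q) / 2 * x ^ 2 * (3 * z + 3 * z ^ 2 + z ^ 3)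
        + x ^ 2 * ((3 + q - q ^ 2) * z - (1 - q / 2) * (1 - q) * z ^ 2)) / (1 + z) ^ 3 := by
    rw [redRR, ← hz]
    field_simp
    ring
  have h2 : (z / (1 + z)) ^ 2 ≤ (3 * z ^ 2 + z ^ 3 + q * (1 + q) / 2 * x ^ 2 * (3 * z + 3 * z ^ 2 + z ^ 3)
        + x ^ 2 * ((3 + q - q ^ 2) * z - (1 - q / 2) * (1 - q) * z ^ 2)) / (1 + z) ^ 3 := by
    rw [div_pow, div_le_div_iff₀ (by positivity) (by positivity)]
    have a5 := redRR_near_aux hq hq1 hx2 hx1 hz0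
    calc z ^ 2 * (1 + z) ^ 3 = z ^ 2 * (1 + z) * (1 + z) ^ 2 := by ring
      _ ≤ _ := by gcongr
  rw [h1]
  have h3 : x ^ 4 * (-C) ≤ x ^ 4 * e := by gcongr
  linarith

lemma redTR_sq_le {q κ x C τ : ℝ} (hq : 0 < q) (hq1 : q < 1) (hκ : 0 < κ) (hx : x ≠ 0)
    (hτ : |τ| ≤ C) : redTR q κ x (-q * x + x ^ 3 * τ) ^ 2 ≤ x ^ 2 *
      (C * x ^ 2 + 5 * (κ * x ^ 2 / (1 + κ * x ^ 2))) ^ 2 := by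
  have hx2 : 0 < x ^ 2 := by positivity
  set z := κ * x ^ 2 with hz
  have hz0 : 0 < z := by positivity
  have hy0 : 0 < 1 + z := by positivity
  have h1 : redTR q κ x (-q * x + x ^ 3 * τ) = x * (x ^ 2 * τ
      - (q * (3 * z + 3 * z ^ 2 + z ^ 3) + 2 * (1 - q / 2) * z) / (1 + z) ^ 3) := by
    rw [redTR, ← hz]
    field_simp
    ring
  have h2 : (q * (3 * z + 3 * z ^ 2 + z ^ 3) + 2 * (1 - q / 2) * z) / (1 + z) ^ 3 ≤ 5 * (z / (1 + z)) := by
    rw [← mul_div_assoc, div_le_div_iff₀ (by positivity) (by positivity)]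
    have a3 := redTR_near_aux hq hq1 hz0
    calc _ ≤ 5 * z * (1 + z) ^ 2 * (1 + z) := by gcongr
      _ = _ := by ring
  have h2' : 0 ≤ (q * (3 * z + 3 * z ^ 2 + z ^ 3) + 2 * (1 - q / 2) * z) / (1 + z) ^ 3 := by
    have : 0 < 1 - q / 2 := by linarith
    positivity
  obtain ⟨ht1, ht2⟩ := abs_le.1 hτ
  have h3 : x ^ 2 * τ ≤ x ^ 2 * C := by gcongr
  have h4 : x ^ 2 * (-C) ≤ x ^ 2 * τ := by gcongr
  rw [h1, mul_pow]
  refine mul_le_mul_of_nonneg_left (sq_le_sq' ?_ ?_) hx2.le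
  · linarith
  · linarith

lemma reduced_near {q κ x C e U τ : ℝ} (hq : 0 < q) (hq1 : q < 1) (hκ : 0 < κ) (hx : x ≠ 0)
    (hx1 : x ^ 2 ≤ 1) (hC : 1 ≤ C) (he : |e| ≤ C) (hτ : |τ| ≤ C) (hU : 0 ≤ U)
    (hUC : U ≤ C * x ^ 4) (hμ : (1 / κ + x ^ 2) * (8 * (C + 5) ^ 2) ≤ 1) :
    0 < redTT q κ x (1 + q * (1 + q) / 2 * x ^ 2 + x ^ 4 * e) U ∧
    redTR q κ x (-q * x + x ^ 3 * τ) ^ 2 <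
      redTT q κ x (1 + q * (1 + q) / 2 * x ^ 2 + x ^ 4 * e) U *
      redRR q κ x (1 + q * (1 + q) / 2 * x ^ 2 + x ^ 4 * e) U := by
  have hx2 : 0 < x ^ 2 := by positivity
  set z := κ * x ^ 2 with hz
  have hz0 : 0 < z := by positivity
  have hy0 : 0 < 1 + z := by positivity
  set μ := 1 / κ + x ^ 2 with hμd
  have hμ0 : 0 < μ := by positivity
  set ρ := z / (1 + z) with hρ
  have hρ0 : 0 < ρ := by positivity
  have hρ1 : ρ ≤ 1 := by rw [hρ, div_le_one hy0]; linarith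
  have hxμ : x ^ 2 = μ * ρ := by
    rw [hμd, hρ, hz]
    field_simp
  have hx4 : x ^ 4 = μ ^ 2 * ρ ^ 2 := by
    calc x ^ 4 = (x ^ 2) ^ 2 := by ring
      _ = _ := by rw [hxμ]; ring
  obtain ⟨he1, he2⟩ := abs_le.1 he
  have hP : ρ - C * x ^ 4 ≤ redTT q κ x (1 + q * (1 + q) / 2 * x ^ 2 + x ^ 4 * e) U :=
    le_redTT hq hκ hx hx1 he1 hU
  have hR : ρ ^ 2 - 2 * C * x ^ 4 ≤ redRR q κ x (1 + q * (1 + q) / 2 * x ^ 2 + x ^ 4 * e) U :=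
    le_redRR hq hq1 hκ hx hx1 he1 hUC
  have hQ : redTR q κ x (-q * x + x ^ 3 * τ) ^ 2 ≤ x ^ 2 * (C * x ^ 2 + 5 * ρ) ^ 2 :=
    redTR_sq_le hq hq1 hκ hx hτ
  have hQμ : C * x ^ 2 + 5 * ρ = ρ * (C * μ + 5) := by rw [hxμ]; ring
  rw [hQμ] at hQ
  clear_value ρ μ
  generalize redTT q κ x (1 + q * (1 + q) / 2 * x ^ 2 + x ^ 4 * e) U = P at *
  generalize redRR q κ x (1 + q * (1 + q) / 2 * x ^ 2 + x ^ 4 * e) U = R at *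
  generalize redTR q κ x (-q * x + x ^ 3 * τ) = Q at *
  have hCμ : C * μ ≤ 1 / 8 := by nlinarith
  have hμ1 : μ ≤ 1 := by nlinarith
  have hCμ2 : C * x ^ 4 ≤ 1 / 8 * ρ ^ 2 := by
    calc C * x ^ 4 = C * μ * μ * ρ ^ 2 := by rw [hx4]; ring
      _ ≤ 1 / 8 * 1 * ρ ^ 2 := by gcongr
      _ = _ := by ring
  have hρρ : ρ ^ 2 ≤ ρ := by nlinarith
  have hP' : ρ / 2 ≤ P := by linarith
  have hR' : ρ ^ 2 / 2 ≤ R := by linarith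
  have hP0 : 0 < P := by linarith
  refine ⟨hP0, ?_⟩
  calc _ ≤ x ^ 2 * (ρ * (C * μ + 5)) ^ 2 := hQ
    _ ≤ x ^ 2 * (ρ * (C + 5)) ^ 2 := by gcongr; nlinarith
    _ = μ * (8 * (C + 5) ^ 2) * (ρ ^ 3 / 8) := by rw [hxμ]; ring
    _ ≤ 1 * (ρ ^ 3 / 8) := by gcongr
    _ < ρ / 2 * (ρ ^ 2 / 2) := by nlinarith [pow_pos hρ0 3]
    _ ≤ _ := by gcongr

lemma reduced_far {q κ x E U T d L : ℝ} (hq : 0 < q) (hq1 : q < 1) (hκ : 0 < κ)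
    (hx1 : x ^ 2 ≤ 1) (hU : 0 ≤ U) (hd : 0 < d) (hE : d ≤ E) (hEL : E ≤ L) (hT : |T| ≤ L)
    (hdet : d ≤ E ^ 2 - U ^ 2 - T ^ 2) (hz1 : 4 < d * (1 + κ * x ^ 2))
    (hz2 : 16 * L < d * (1 + κ * x ^ 2)) :
    0 < redTT q κ x E U ∧ redTR q κ x T ^ 2 < redTT q κ x E U * redRR q κ x E U := by
  have hx2 : 0 ≤ x ^ 2 := sq_nonneg x
  have hxa : |x| ≤ 1 := (sq_le_one_iff_abs_le_one x).1 hx1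
  obtain ⟨hxl, hxr⟩ := abs_le.1 hxa
  set z := κ * x ^ 2 with hz
  have hz0 : 0 ≤ z := by positivity
  have hy0 : 0 < 1 + z := by positivity
  set ε := 4 / (1 + z) with hε
  have hε0 : 0 < ε := by positivity
  have key : ∀ a : ℝ, a ≤ 4 * (1 + z) ^ 2 → a / (1 + z) ^ 3 ≤ ε := by
    intro a ha
    rw [hε, div_le_div_iff₀ (by positivity) hy0]
    calc a * (1 + z) ≤ 4 * (1 + z) ^ 2 * (1 + z) := by gcongr
      _ = _ := by ring
  have hεd : ε < d := by rw [hε, div_lt_iff₀ hy0]; linarith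
  have hεL : 4 * L * ε < d := by
    rw [hε, ← mul_div_assoc, div_lt_iff₀ hy0]; linarith
  have hP : E + U - ε ≤ redTT q κ x E U := by
    rw [redTT, ← hz]
    have := key (1 - 3 * z * (1 - x ^ 2) + x ^ 2 * (((1 - q / 2) * z - q / 2) ^ 2
      - q / 2 * (1 + z) * (2 - (1 - q / 2) * (1 + z)))) (redTT_far_aux hq hq1 hx2 hx1 hz0)
    linarith
  have hR : E - U - ε ≤ redRR q κ x E U := by
    rw [redRR, ← hz]
    have := key (1 + 3 * z * (1 - x ^ 2) + x ^ 2 * (((1 - q / 2) * z - q / 2) ^ 2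
      + q / 2 * (1 + z) * (2 - (1 - q / 2) * (1 + z)))) (redRR_far_aux hq hq1 hx2 hx1 hz0)
    linarith
  have hQ : |redTR q κ x T| ≤ |T| + ε := by
    rw [redTR, ← hz]
    refine (abs_sub _ _).trans ?_
    gcongr
    rw [abs_div, abs_of_pos (show 0 < (1 + z) ^ 3 by positivity)]
    exact key _ (redTR_far_aux hq hq1 hxa hz0)
  have hab : 0 ≤ T ^ 2 := sq_nonneg T
  have hUE : U < E := lt_of_pow_lt_pow_left₀ 2 (by linarith) (by linarith)
  have hdet' : 0 < (E + U) * (E - U - ε) := by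
    nlinarith
  have hRpos : 0 < E - U - ε := by
    by_contra! h
    nlinarith
  refine ⟨by linarith, ?_⟩
  have hT0 := abs_nonneg T
  calc redTR q κ x T ^ 2 = |redTR q κ x T| ^ 2 := (sq_abs _).symm
    _ ≤ (|T| + ε) ^ 2 := by gcongr
    _ < (E + U - ε) * (E - U - ε) := by
      have hTT := sq_abs T
      have : ε * (2 * E + 2 * |T|) ≤ ε * (4 * L) := by gcongr; linarith
      nlinarith
    _ ≤ _ := mul_le_mul hP hR hRpos.le (by linarith)

lemma exists_bound {f : ℝ → ℝ} (hf : Continuous f) : ∃ C, ∀ x, |x| ≤ 1 → |f x| ≤ C := by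
  obtain ⟨C, hC⟩ := (isCompact_Icc (a := (-1 : ℝ)) (b := 1)).exists_bound_of_continuousOn
    hf.continuousOn
  exact ⟨C, fun x hx => hC x (abs_le.1 hx)⟩

lemma exists_lower_bound {f : ℝ → ℝ} (hf : Continuous f) (hpos : ∀ x, |x| ≤ 1 → 0 < f x) :
    ∃ d, 0 < d ∧ ∀ x, |x| ≤ 1 → d ≤ f x := by
  obtain ⟨x₀, hx₀, h⟩ := (isCompact_Icc (a := (-1 : ℝ)) (b := 1)).exists_isMinOn
    ⟨0, by simp⟩ hf.continuousOn
  exact ⟨f x₀, hpos _ (abs_le.2 hx₀), fun x hx => h (abs_le.1 hx)⟩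

lemma IsProfile.exists_reduced_posDef {q : ℝ} {e τ w : ℝ → ℝ} (h : IsProfile q e τ w)
    (hq : 0 < q) (hq1 : q < 1) : ∃ κ : ℝ, 0 < κ ∧ ∀ x, |x| ≤ 1 → x ≠ 0 →
      0 < redTT q κ x (profE q e x) ((2 + q) / q * profV w x) ∧
      redTR q κ x (profT q τ x) ^ 2 < redTT q κ x (profE q e x) ((2 + q) / q * profV w x) *
        redRR q κ x (profE q e x) ((2 + q) / q * profV w x) := by
  have ce := h.smooth_e.continuous
  have ct := h.smooth_t.continuous
  have cw := h.smooth_w.continuous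
  have cE : Continuous (profE q e) := by unfold profE; fun_prop
  have cT : Continuous (profT q τ) := by unfold profT; fun_prop
  have cV : Continuous (profV w) := by unfold profV; fun_prop
  obtain ⟨C₁, hC₁⟩ := exists_bound ce
  obtain ⟨C₂, hC₂⟩ := exists_bound ct
  obtain ⟨C₃, hC₃⟩ := exists_bound (cw.const_mul ((2 + q) / q))
  obtain ⟨L₁, hL₁⟩ := exists_bound cE
  obtain ⟨L₂, hL₂⟩ := exists_bound cT
  obtain ⟨d₁, hd₁, hd₁'⟩ := exists_lower_bound cE h.e_pos
  obtain ⟨d₂, hd₂, hd₂'⟩ := exists_lower_bound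
    (f := fun x => profE q e x ^ 2 - ((2 + q) / q * profV w x) ^ 2 - profT q τ x ^ 2)
    (by fun_prop) (fun x hx => by have := h.gram x hx; linarith)
  set C := max (max C₁ C₂) (max C₃ 1) with hC
  set L := max L₁ L₂ with hL
  set d := min d₁ d₂ with hd
  have hd0 : 0 < d := lt_min hd₁ hd₂
  have hC1 : 1 ≤ C := (le_max_right _ _).trans (le_max_right _ _)
  have hL0 : 0 ≤ L := (abs_nonneg _).trans ((hL₁ 0 (by simp)).trans (le_max_left _ _))
  set η := 1 / (16 * (C + 5) ^ 2) with hη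
  have hη0 : 0 < η := by positivity
  set κ := 1 / η + (4 + 16 * L) / (d * η) with hκ
  have hκ0 : 0 < κ := by positivity
  refine ⟨κ, hκ0, fun x hx hx0 => ?_⟩
  have hx1 : x ^ 2 ≤ 1 := (sq_le_one_iff_abs_le_one x).2 hx
  have hV0 : 0 ≤ (2 + q) / q * profV w x := by
    have := h.w_nonneg x hx
    unfold profV; positivity
  rcases le_total (x ^ 2) η with hxη | hxη
  · refine reduced_near hq hq1 hκ0 hx0 hx1 hC1
      ((hC₁ x hx).trans ((le_max_left _ _).trans (le_max_left _ _)))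
      ((hC₂ x hx).trans ((le_max_right _ _).trans (le_max_left _ _))) hV0 ?_ ?_
    · have h1 : (2 + q) / q * w x ≤ C := (le_abs_self _).trans
        ((hC₃ x hx).trans ((le_max_left _ _).trans (le_max_right _ _)))
      calc (2 + q) / q * profV w x = (2 + q) / q * w x * x ^ 4 := by unfold profV; ring
        _ ≤ _ := by gcongr
    · have h1 : 1 / κ ≤ η := by
        rw [div_le_iff₀ hκ0, hκ, mul_add]
        have : 0 ≤ η * ((4 + 16 * L) / (d * η)) := by positivity
        have : η * (1 / η) = 1 := by field_simp
        linarith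
      calc (1 / κ + x ^ 2) * (8 * (C + 5) ^ 2) ≤ (η + η) * (8 * (C + 5) ^ 2) := by gcongr
        _ = 1 := by rw [hη]; field_simp; norm_num
  · have hz : 4 + 16 * L < d * (1 + κ * x ^ 2) := by
      have h1 : κ * η ≤ κ * x ^ 2 := by gcongr
      have h2 : d * (κ * η) = d + (4 + 16 * L) := by rw [hκ]; field_simp
      nlinarith
    exact reduced_far hq hq1 hκ0 hx1 hV0 hd0 ((min_le_left _ _).trans (hd₁' x hx))
      ((le_abs_self _).trans ((hL₁ x hx).trans (le_max_left _ _)))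
      ((hL₂ x hx).trans (le_max_right _ _)) ((min_le_right _ _).trans (hd₂' x hx))
      (by linarith) (by linarith)

/-- The mass profile. -/
def mass (κ x : ℝ) : ℝ := 2 * x ^ 2 / (1 + κ * x ^ 2)

/-- The derivative of the mass profile. -/
def massDeriv (κ x : ℝ) : ℝ := 4 * x / (1 + κ * x ^ 2) ^ 2

/-- The second derivative of the mass profile. -/
def massDeriv₂ (κ x : ℝ) : ℝ := 4 * (1 - 3 * (κ * x ^ 2)) / (1 + κ * x ^ 2) ^ 3

/-- The profile of the wave operator applied to the mass. -/
def massBox (q κ x : ℝ) : ℝ :=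
  (2 - q) * (1 - q) * mass κ x - 2 * (1 - q) * (x * massDeriv κ x) + x ^ 2 * massDeriv₂ κ x
    - massDeriv₂ κ x

section mass

variable {κ : ℝ}

lemma one_add_mul_sq_pos (hκ : 0 < κ) (x : ℝ) : 0 < 1 + κ * x ^ 2 := by positivity

lemma hasDerivAt_mass (hκ : 0 < κ) (x : ℝ) : HasDerivAt (mass κ) (massDeriv κ x) x := by
  have hy := one_add_mul_sq_pos hκ x
  have h := (((hasDerivAt_pow 2 x).const_mul 2).fun_div
    (((hasDerivAt_pow 2 x).const_mul κ).const_add 1) hy.ne')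
  refine h.congr_deriv ?_
  unfold massDeriv
  field_simp
  push_cast
  ring

lemma hasDerivAt_massDeriv (hκ : 0 < κ) (x : ℝ) :
    HasDerivAt (massDeriv κ) (massDeriv₂ κ x) x := by
  have hy := one_add_mul_sq_pos hκ x
  have h := (((hasDerivAt_id' x).const_mul 4).fun_div
    ((((hasDerivAt_pow 2 x).const_mul κ).const_add 1).fun_pow 2) (pow_pos hy 2).ne')
  refine h.congr_deriv ?_
  unfold massDeriv₂
  field_simp
  push_cast
  ring

lemma deriv_mass (hκ : 0 < κ) : deriv (mass κ) = massDeriv κ :=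
  funext fun x => (hasDerivAt_mass hκ x).deriv

lemma deriv_massDeriv (hκ : 0 < κ) : deriv (massDeriv κ) = massDeriv₂ κ :=
  funext fun x => (hasDerivAt_massDeriv hκ x).deriv

lemma contDiff_div_pow (hκ : 0 < κ) {f : ℝ → ℝ} (hf : ContDiff ℝ (⊤ : ℕ∞) f) (n : ℕ) :
    ContDiff ℝ (⊤ : ℕ∞) (fun x => f x / (1 + κ * x ^ 2) ^ n) :=
  hf.div (by fun_prop) fun x => (pow_pos (one_add_mul_sq_pos hκ x) n).ne'

lemma contDiff_mass (hκ : 0 < κ) : ContDiff ℝ (⊤ : ℕ∞) (mass κ) := by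
  have := contDiff_div_pow hκ (f := fun x => 2 * x ^ 2) (by fun_prop) 1
  simp only [pow_one] at this
  exact this

lemma contDiff_massDeriv (hκ : 0 < κ) : ContDiff ℝ (⊤ : ℕ∞) (massDeriv κ) :=
  contDiff_div_pow hκ (f := fun x => 4 * x) (by fun_prop) 2

lemma contDiff_massDeriv₂ (hκ : 0 < κ) : ContDiff ℝ (⊤ : ℕ∞) (massDeriv₂ κ) :=
  contDiff_div_pow hκ (f := fun x => 4 * (1 - 3 * (κ * x ^ 2))) (by fun_prop) 3

lemma contDiff_massBox (hκ : 0 < κ) (q : ℝ) : ContDiff ℝ (⊤ : ℕ∞) (massBox q κ) := by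
  have h0 := contDiff_mass hκ
  have h1 := contDiff_massDeriv hκ
  have h2 := contDiff_massDeriv₂ hκ
  unfold massBox
  fun_prop

lemma mass_neg (x : ℝ) : mass κ (-x) = mass κ x := by simp [mass]

lemma massBox_neg (q x : ℝ) : massBox q κ (-x) = massBox q κ x := by
  simp only [massBox, mass, massDeriv, massDeriv₂]
  ring_nf

lemma pdt_mass (hκ : 0 < κ) {q : ℝ} {a : ℝ × ℝ} (ha : 0 < a.1) :
    pdt (homExt (2 - q) (mass κ)) a
      = homExt (1 - q) (fun x => (2 - q) * mass κ x - x * massDeriv κ x) a := by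
  rw [pdt_homExt (contDiff_mass hκ).differentiable_top ha, deriv_mass hκ]
  ring_nf

lemma pdr_mass (hκ : 0 < κ) {q : ℝ} {a : ℝ × ℝ} (ha : 0 < a.1) :
    pdr (homExt (2 - q) (mass κ)) a = homExt (1 - q) (massDeriv κ) a := by
  rw [pdr_homExt (contDiff_mass hκ).differentiable_top ha, deriv_mass hκ]
  ring_nf

lemma pdr_pdr_mass (hκ : 0 < κ) {q : ℝ} {a : ℝ × ℝ} (ha : 0 < a.1) :
    pdr (pdr (homExt (2 - q) (mass κ))) a = homExt (-q) (massDeriv₂ κ) a := by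
  rw [pdr_congr (fun b hb => pdr_mass hκ hb) ha,
    pdr_homExt (contDiff_massDeriv hκ).differentiable_top ha, deriv_massDeriv hκ]
  ring_nf

lemma pdt_pdt_mass (hκ : 0 < κ) {q : ℝ} {a : ℝ × ℝ} (ha : 0 < a.1) :
    pdt (pdt (homExt (2 - q) (mass κ))) a = homExt (-q) (fun x => (2 - q) * (1 - q) * mass κ x
      - 2 * (1 - q) * (x * massDeriv κ x) + x ^ 2 * massDeriv₂ κ x) a := by
  have h0 := contDiff_mass hκ
  have h1 := contDiff_massDeriv hκ
  have hd : ∀ x, deriv (fun x => (2 - q) * mass κ x - x * massDeriv κ x) x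
      = (2 - q) * massDeriv κ x - (1 * massDeriv κ x + x * massDeriv₂ κ x) := fun x =>
    (((hasDerivAt_mass hκ x).const_mul (2 - q)).fun_sub
      ((hasDerivAt_id' x).fun_mul (hasDerivAt_massDeriv hκ x))).deriv
  have hf : ContDiff ℝ (⊤ : ℕ∞) (fun x => (2 - q) * mass κ x - x * massDeriv κ x) := by fun_prop
  rw [pdt_congr (fun b hb => pdt_mass hκ hb) ha, pdt_homExt hf.differentiable_top ha]
  simp only [homExt, hd]
  ring_nf

lemma mass_mul_redTT (hκ : 0 < κ) {q x E U : ℝ} (hx : x ≠ 0) : mass κ x * redTT q κ x E U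
    = mass κ x * (E + (U + massBox q κ x / 4))
      - (1 / 2 * ((2 - q) * mass κ x - x * massDeriv κ x)) ^ 2 := by
  have hy := one_add_mul_sq_pos hκ x
  simp only [redTT, massBox, mass, massDeriv, massDeriv₂]
  field_simp
  ring

lemma mass_mul_redRR (hκ : 0 < κ) {q x E U : ℝ} (hx : x ≠ 0) : mass κ x * redRR q κ x E U
    = mass κ x * (E - (U + massBox q κ x / 4)) - (1 / 2 * massDeriv κ x) ^ 2 := by
  have hy := one_add_mul_sq_pos hκ x
  simp only [redRR, massBox, mass, massDeriv, massDeriv₂]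
  field_simp
  ring

lemma mass_mul_redTR (hκ : 0 < κ) {q x T : ℝ} (hx : x ≠ 0) : mass κ x * redTR q κ x T
    = mass κ x * T - 1 / 2 * ((2 - q) * mass κ x - x * massDeriv κ x)
      * (1 / 2 * massDeriv κ x) := by
  have hy := one_add_mul_sq_pos hκ x
  simp only [redTR, mass, massDeriv]
  field_simp
  ring

end mass

lemma posDef_fin_three {a b c d e f : ℝ} (ha : 0 < a) (hd : 0 < a * d - b ^ 2)
    (hdet : (a * e - b * c) ^ 2 < (a * d - b ^ 2) * (a * f - c ^ 2)) :
    (!![a, b, c; b, d, e; c, e, f] : Matrix (Fin 3) (Fin 3) ℝ).PosDef := by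
  refine Matrix.PosDef.of_dotProduct_mulVec_pos ?_ fun v hv => ?_
  · ext i j
    fin_cases i <;> fin_cases j <;> simp [Matrix.conjTranspose]
  · have hform : dotProduct (star v)
        ((!![a, b, c; b, d, e; c, e, f] : Matrix (Fin 3) (Fin 3) ℝ).mulVec v)
        = a * v 0 ^ 2 + d * v 1 ^ 2 + f * v 2 ^ 2 + 2 * b * v 0 * v 1 + 2 * c * v 0 * v 2
          + 2 * e * v 1 * v 2 := by
      simp [dotProduct, Matrix.mulVec, Fin.sum_univ_three]
      ring
    rw [hform]
    set F := a * v 0 ^ 2 + d * v 1 ^ 2 + f * v 2 ^ 2 + 2 * b * v 0 * v 1 + 2 * c * v 0 * v 2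
          + 2 * e * v 1 * v 2 with hF
    have h1 : a * (a * d - b ^ 2) * F = (a * d - b ^ 2) * (a * v 0 + b * v 1 + c * v 2) ^ 2
        + ((a * d - b ^ 2) * v 1 + (a * e - b * c) * v 2) ^ 2
        + ((a * d - b ^ 2) * (a * f - c ^ 2) - (a * e - b * c) ^ 2) * v 2 ^ 2 := by
      rw [hF]; ring
    have hD := sub_pos.2 hdet
    have h2 : 0 < a * (a * d - b ^ 2) * F := by
      rw [h1]
      by_cases v2 : v 2 = 0
      · by_cases v1 : v 1 = 0
        · have v0 : v 0 ≠ 0 := fun v0 => hv (by ext i; fin_cases i <;> simp [v0, v1, v2])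
          simp only [v1, v2]
          have : 0 < (a * v 0) ^ 2 := by positivity
          have := mul_pos hd this
          simpa using this
        · simp only [v2]
          have h3 : 0 < ((a * d - b ^ 2) * v 1) ^ 2 := by positivity
          have h4 : 0 ≤ (a * d - b ^ 2) * (a * v 0 + b * v 1 + c * 0) ^ 2 := by positivity
          simp only [mul_zero, add_zero] at h4 ⊢
          nlinarith
      · have : 0 < ((a * d - b ^ 2) * (a * f - c ^ 2) - (a * e - b * c) ^ 2) * v 2 ^ 2 := by
          positivity
        positivity
    exact pos_of_mul_pos_right h2 (by positivity)

lemma deriv_deriv_sq_mul {ρ : ℝ → ℝ} (hρ : ContDiff ℝ (⊤ : ℕ∞) ρ) :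
    deriv (deriv (fun x => x ^ 2 * ρ x)) 0 = 2 * ρ 0 := by
  have h1 : deriv (fun x => x ^ 2 * ρ x) = fun x => x * (2 * ρ x + x * deriv ρ x) := by
    funext x
    refine ((hasDerivAt_pow 2 x).fun_mul (hρ.differentiable_top x).hasDerivAt).deriv.trans ?_
    push_cast
    ring
  have h2 : DifferentiableAt ℝ (fun x => 2 * ρ x + x * deriv ρ x) 0 := by
    have h3 := hρ.deriv_top
    have h4 : ContDiff ℝ (⊤ : ℕ∞) (fun x => 2 * ρ x + x * deriv ρ x) := by fun_prop
    exact h4.differentiable_top 0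
  rw [h1]
  refine ((hasDerivAt_id' (0 : ℝ)).fun_mul h2.hasDerivAt).deriv.trans ?_
  simp

lemma vanishOrder_mass {κ : ℝ} (hκ : 0 < κ) (q : ℝ) :
    VanishOrder 2 (homExt (2 - q) (mass κ)) := by
  have h := contDiff_div_pow hκ (f := fun _ => (2 : ℝ)) (by fun_prop) 1
  refine vanishOrder_of_eq (α := 2 - q) h fun a _ => ?_
  simp only [homExt, mass]
  ring

/-- The time-time energy profile. -/
def profTT (q κ : ℝ) (e w : ℝ → ℝ) (x : ℝ) : ℝ :=
  profE q e x + ((2 + q) / q * profV w x + massBox q κ x / 4)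

/-- The space-space energy profile. -/
def profRR (q κ : ℝ) (e w : ℝ → ℝ) (x : ℝ) : ℝ :=
  profE q e x - ((2 + q) / q * profV w x + massBox q κ x / 4)

/-- The quotient of `profTT` by `x ^ 2`. -/
def quotTT (q κ : ℝ) (e w : ℝ → ℝ) (x : ℝ) : ℝ :=
  x ^ 2 * e x + (2 + q) / q * (x ^ 2 * w x) + (κ * (6 + 3 * (κ * x ^ 2) + (κ * x ^ 2) ^ 2)
    + q * (1 + q) / 2 * (1 + κ * x ^ 2) ^ 3 + (2 - q) * (1 - q) / 2 * (1 + κ * x ^ 2) ^ 2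
    - 2 * (1 - q) * (1 + κ * x ^ 2) + (1 - 3 * (κ * x ^ 2))) / (1 + κ * x ^ 2) ^ 3

lemma profTT_eq {q κ : ℝ} (hκ : 0 < κ) (e w : ℝ → ℝ) (x : ℝ) :
    profTT q κ e w x = x ^ 2 * quotTT q κ e w x := by
  have hy := one_add_mul_sq_pos hκ x
  simp only [profTT, quotTT, profE, profV, massBox, mass, massDeriv, massDeriv₂]
  field_simp
  ring

lemma contDiff_quotTT {q κ : ℝ} (hκ : 0 < κ) {e w : ℝ → ℝ} (he : ContDiff ℝ (⊤ : ℕ∞) e)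
    (hw : ContDiff ℝ (⊤ : ℕ∞) w) : ContDiff ℝ (⊤ : ℕ∞) (quotTT q κ e w) := by
  have h := contDiff_div_pow hκ (f := fun x => κ * (6 + 3 * (κ * x ^ 2) + (κ * x ^ 2) ^ 2)
    + q * (1 + q) / 2 * (1 + κ * x ^ 2) ^ 3 + (2 - q) * (1 - q) / 2 * (1 + κ * x ^ 2) ^ 2
    - 2 * (1 - q) * (1 + κ * x ^ 2) + (1 - 3 * (κ * x ^ 2))) (by fun_prop) 3
  unfold quotTT
  fun_prop

lemma vanishOrder_profTR {q κ : ℝ} (hκ : 0 < κ) {τ : ℝ → ℝ} (hτ : ContDiff ℝ (⊤ : ℕ∞) τ) :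
    VanishOrder 4 (fun a => 2 * a.2 * homExt (-q) (profT q τ) a
      - pdt (homExt (2 - q) (mass κ)) a) := by
  have h := contDiff_div_pow hκ (f := fun x => 2 * κ * (q * (1 + κ * x ^ 2) + 2)) (by fun_prop) 2
  refine vanishOrder_of_eq (α := 1 - q) (ρ := fun x => 2 * τ x
    - 2 * κ * (q * (1 + κ * x ^ 2) + 2) / (1 + κ * x ^ 2) ^ 2) (by fun_prop) fun a ha => ?_
  obtain ⟨x, hx⟩ : ∃ x, a.2 / a.1 = x := ⟨_, rfl⟩
  have hr : a.2 = x * a.1 := by rw [← hx]; field_simp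
  have hy := one_add_mul_sq_pos hκ x
  have ht : a.1 ^ (1 - q) = a.1 ^ (-q) * a.1 := by
    rw [← Real.rpow_add_one ha.ne']; ring_nf
  rw [pdt_mass hκ ha]
  simp only [homExt, hx, ht]
  rw [hr]
  simp only [profT, mass, massDeriv]
  field_simp
  ring

lemma vanishOrder_profRR {q κ : ℝ} (hκ : 0 < κ) {e w : ℝ → ℝ} (he : ContDiff ℝ (⊤ : ℕ∞) e)
    (hw : ContDiff ℝ (⊤ : ℕ∞) w) :
    VanishOrder 6 (fun a => a.2 ^ 2 * homExt (-q) (profRR q κ e w) a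
      - a.2 * pdr (homExt (2 - q) (mass κ)) a + homExt (2 - q) (mass κ) a) := by
  have h := contDiff_div_pow hκ (f := fun x => 5 * κ ^ 2 + κ ^ 3 * x ^ 2
    + κ * ((3 * (q * (1 + q) / 2) - (2 - q) * (1 - q) + 5 - 2 * q)
      + (3 * (q * (1 + q) / 2) - (2 - q) * (1 - q) / 2) * (κ * x ^ 2)
      + q * (1 + q) / 2 * (κ * x ^ 2) ^ 2)) (by fun_prop) 3
  refine vanishOrder_of_eq (α := 2 - q) (ρ := fun x => e x - (2 + q) / q * w x
    + (5 * κ ^ 2 + κ ^ 3 * x ^ 2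
    + κ * ((3 * (q * (1 + q) / 2) - (2 - q) * (1 - q) + 5 - 2 * q)
      + (3 * (q * (1 + q) / 2) - (2 - q) * (1 - q) / 2) * (κ * x ^ 2)
      + q * (1 + q) / 2 * (κ * x ^ 2) ^ 2)) / (1 + κ * x ^ 2) ^ 3) (by fun_prop) fun a ha => ?_
  obtain ⟨x, hx⟩ : ∃ x, a.2 / a.1 = x := ⟨_, rfl⟩
  have hr : a.2 = x * a.1 := by rw [← hx]; field_simp
  have hy := one_add_mul_sq_pos hκ x
  have ht : a.1 ^ (1 - q) = a.1 ^ (-q) * a.1 := by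
    rw [← Real.rpow_add_one ha.ne']; ring_nf
  have ht2 : a.1 ^ (2 - q) = a.1 ^ (-q) * a.1 ^ 2 := by
    rw [← Real.rpow_add_natCast ha.ne']; push_cast; ring_nf
  rw [pdr_mass hκ ha]
  simp only [homExt, hx, ht, ht2]
  rw [hr]
  generalize a.1 ^ (-q) = A
  generalize a.1 = t
  have hx6 : x ^ 2 * profRR q κ e w x - x * massDeriv κ x + mass κ x = x ^ 6 * (e x
    - (2 + q) / q * w x + (5 * κ ^ 2 + κ ^ 3 * x ^ 2
    + κ * ((3 * (q * (1 + q) / 2) - (2 - q) * (1 - q) + 5 - 2 * q)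
      + (3 * (q * (1 + q) / 2) - (2 - q) * (1 - q) / 2) * (κ * x ^ 2)
      + q * (1 + q) / 2 * (κ * x ^ 2) ^ 2)) / (1 + κ * x ^ 2) ^ 3) := by
    simp only [profRR, profE, profV, massBox, mass, massDeriv, massDeriv₂]
    generalize (2 + q) / q = B
    field_simp
    ring
  linear_combination A * t ^ 2 * hx6

lemma IsProfile.transport {q : ℝ} {e τ w : ℝ → ℝ} (h : IsProfile q e τ w) {a : ℝ × ℝ}
    (ha : 0 < a.1) (hr : a.2 ≠ 0) :
    (pdt (homExt (-q) (fun x => profE q e x + profT q τ x)) a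
      - pdr (homExt (-q) (fun x => profE q e x + profT q τ x)) a)
      + (pdt (homExt (-q) (profV w)) a + pdr (homExt (-q) (profV w)) a)
      = -(4 / q / a.2) * homExt (-q) (profV w) a := by
  have he := h.smooth_e
  have ht := h.smooth_t
  have hw := h.smooth_w
  have cE : ContDiff ℝ (⊤ : ℕ∞) (profE q e) := by unfold profE; fun_prop
  have cT : ContDiff ℝ (⊤ : ℕ∞) (profT q τ) := by unfold profT; fun_prop
  have cV : ContDiff ℝ (⊤ : ℕ∞) (profV w) := by unfold profV; fun_prop
  have dE := cE.differentiable_top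
  have dT := cT.differentiable_top
  have dV := cV.differentiable_top
  have hd : ∀ x, deriv (fun x => profE q e x + profT q τ x) x
      = deriv (profE q e) x + deriv (profT q τ) x := fun x => deriv_fun_add (dE x) (dT x)
  rw [pdt_homExt (dE.fun_add dT) ha, pdr_homExt (dE.fun_add dT) ha, pdt_homExt dV ha,
    pdr_homExt dV ha]
  obtain ⟨x, hx⟩ : ∃ x, a.2 / a.1 = x := ⟨_, rfl⟩
  have hra : a.2 = x * a.1 := by rw [← hx]; field_simp
  have hx0 : x ≠ 0 := by rintro rfl; exact hr (by rw [hra, zero_mul])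
  have h1 := h.energy x
  have h2 := h.momentum x
  simp only [homExt, hd, hx, Real.rpow_sub_one ha.ne']
  rw [hra]
  have h3 : -q * profT q τ x - x * deriv (profT q τ) x - deriv (profE q e) x
      + deriv (profV w) x = -(4 / q / x) * profV w x := by
    rw [← mul_right_inj' hx0, h2]; field_simp
  have h4 : -(4 / q / (x * a.1)) = -(4 / q / x) / a.1 := by rw [neg_div, div_div (4 / q)]
  rw [h4]
  linear_combination a.1 ^ (-q) / a.1 * (h1 + h3)

lemma IsProfile.posDef_mat3 {q κ : ℝ} {e τ w : ℝ → ℝ} (hκ : 0 < κ) {a : ℝ × ℝ} (ha : 0 < a.1)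
    (hr : a.2 ≠ 0)
    (hP : 0 < redTT q κ (a.2 / a.1) (profE q e (a.2 / a.1)) ((2 + q) / q * profV w (a.2 / a.1)))
    (hQ : redTR q κ (a.2 / a.1) (profT q τ (a.2 / a.1)) ^ 2 <
      redTT q κ (a.2 / a.1) (profE q e (a.2 / a.1)) ((2 + q) / q * profV w (a.2 / a.1)) *
      redRR q κ (a.2 / a.1) (profE q e (a.2 / a.1)) ((2 + q) / q * profV w (a.2 / a.1))) :
    (mat3 (homExt (2 - q) (mass κ)) (homExt (-q) (profTT q κ e w)) (homExt (-q) (profRR q κ e w))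
      (homExt (-q) (profT q τ)) a).PosDef := by
  unfold mat3
  rw [pdt_mass hκ ha, pdr_mass hκ ha]
  obtain ⟨x, hx⟩ : ∃ x, a.2 / a.1 = x := ⟨_, rfl⟩
  have hx0 : x ≠ 0 := by rw [← hx]; exact div_ne_zero hr ha.ne'
  have ht : a.1 ^ (1 - q) = a.1 ^ (-q) * a.1 := by
    rw [← Real.rpow_add_one ha.ne']; ring_nf
  have ht2 : a.1 ^ (2 - q) = a.1 ^ (-q) * a.1 ^ 2 := by
    rw [← Real.rpow_add_natCast ha.ne']; push_cast; ring_nf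
  have hA : 0 < a.1 ^ (-q) := Real.rpow_pos_of_pos ha _
  rw [hx] at hP hQ
  simp only [homExt, hx, ht, ht2]
  generalize a.1 ^ (-q) = A at *
  generalize a.1 = t at *
  have hm : 0 < mass κ x := by
    have := one_add_mul_sq_pos hκ x
    unfold mass; positivity
  have e1 := mass_mul_redTT hκ (q := q) (E := profE q e x) (U := (2 + q) / q * profV w x) hx0
  have e2 := mass_mul_redRR hκ (q := q) (E := profE q e x) (U := (2 + q) / q * profV w x) hx0
  have e3 := mass_mul_redTR hκ (q := q) (T := profT q τ x) hx0
  rw [← profTT] at e1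
  rw [← profRR] at e2
  generalize redTT q κ x (profE q e x) ((2 + q) / q * profV w x) = P at *
  generalize redRR q κ x (profE q e x) ((2 + q) / q * profV w x) = R at *
  generalize redTR q κ x (profT q τ x) = Q at *
  have f1 : A * t ^ 2 * mass κ x * (A * profTT q κ e w x)
      - (1 / 2 * (A * t * ((2 - q) * mass κ x - x * massDeriv κ x))) ^ 2
      = (A * t) ^ 2 * mass κ x * P := by linear_combination -(A * t) ^ 2 * e1
  have f2 : A * t ^ 2 * mass κ x * (A * profRR q κ e w x)
      - (1 / 2 * (A * t * massDeriv κ x)) ^ 2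
      = (A * t) ^ 2 * mass κ x * R := by linear_combination -(A * t) ^ 2 * e2
  have f3 : A * t ^ 2 * mass κ x * (A * profT q τ x)
      - 1 / 2 * (A * t * ((2 - q) * mass κ x - x * massDeriv κ x))
        * (1 / 2 * (A * t * massDeriv κ x))
      = (A * t) ^ 2 * mass κ x * Q := by linear_combination -(A * t) ^ 2 * e3
  refine posDef_fin_three (by positivity) (by rw [f1]; positivity) ?_
  rw [f1, f2, f3]
  have h5 : 0 < ((A * t) ^ 2 * mass κ x) ^ 2 := by positivity
  have h6 := mul_lt_mul_of_pos_left hQ h5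
  linear_combination h6

/-- Theorem 5.2, fifth reduction.
The vanishing conditions `Ẽ_tr - (1/(2r))∂_t M̃ = O(r³)` and
`Ẽ_rr - (1/r)∂_r M̃ + (1/r²)M̃ = O(r⁴)` at `r = 0` are expressed in the equivalent
cleared-denominator form: `2r·Ẽ_tr - ∂_t M̃` vanishes to fourth order and
`r²·Ẽ_rr - r·∂_r M̃ + M̃` vanishes to sixth order at `r = 0`. -/
theorem stmt9 (p : ℝ) (hp : 5 < p) :
    ∃ Mt Ett Err Etr : ℝ × ℝ → ℝ,
      SmoothOnCone1 Mt ∧ SmoothOnCone1 Ett ∧ SmoothOnCone1 Err ∧ SmoothOnCone1 Etr ∧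
      IsEvenR Mt ∧ IsEvenR Ett ∧ IsEvenR Err ∧ IsOddR Etr ∧
      HomogOrder ((2 * p - 6) / (p - 1)) Mt ∧
      HomogOrder (-(4 / (p - 1))) Ett ∧
      HomogOrder (-(4 / (p - 1))) Etr ∧
      HomogOrder (-(4 / (p - 1))) Err ∧
      -- `M̃` and `Ẽ_tt` vanish to second order at `r = 0`
      VanishOrder 2 Mt ∧ VanishOrder 2 Ett ∧
      -- `Ẽ_tr - (1/(2r)) ∂_t M̃` vanishes to third order at `r = 0`
      VanishOrder 4 (fun q => 2 * q.2 * Etr q - pdt Mt q) ∧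
      -- `Ẽ_rr - (1/r) ∂_r M̃ + (1/r²) M̃` vanishes to fourth order at `r = 0`
      VanishOrder 6 (fun q => q.2 ^ 2 * Err q - q.2 * pdr Mt q + Mt q) ∧
      -- with `V` and `e₊` defined by their formulas:
      (∀ V ePlus : ℝ × ℝ → ℝ,
        V = (fun q => (1 / (p + 1)) *
              ((1 / 2) * (-(pdt (pdt Mt) q) + pdr (pdr Mt) q) + Ett q - Err q)) →
        ePlus = (fun q => (1 / 2) * Ett q + (1 / 2) * Err q + Etr q) →
          -- (i) weak defocusing
          (∀ q ∈ Cone1, 0 ≤ V q) ∧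
          -- (ii) the null transport equation
          (∀ q ∈ Cone1, q.2 ≠ 0 →
            (pdt ePlus q - pdr ePlus q) + (pdt V q + pdr V q) = -((p - 1) / q.2) * V q)) ∧
      -- (iii) strict positive definiteness away from `r = 0`
      (∀ q ∈ Cone1, q.2 ≠ 0 → (mat3 Mt Ett Err Etr q).PosDef) ∧
      -- (iv) the condition at `r = 0`
      ((2 / (p - 1)) ^ 2 * pdr (pdr Mt) (1, 0) < pdr (pdr Ett) (1, 0) ∧
        0 < pdr (pdr Mt) (1, 0)) := by
  have hp1 : 0 < p - 1 := by linarith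
  obtain ⟨q, hqp⟩ : ∃ q, 4 / (p - 1) = q := ⟨_, rfl⟩
  have hq : 0 < q := by rw [← hqp]; positivity
  have hq1 : q < 1 := by rw [← hqp, div_lt_one hp1]; linarith
  have h1 : p - 1 = 4 / q := by rw [← hqp]; field_simp
  have h2 : (2 * p - 6) / (p - 1) = 2 - q := by rw [← hqp]; field_simp; ring
  have h3 : p + 1 = (4 + 2 * q) / q := by
    have : p + 1 = p - 1 + 2 := by ring
    rw [this, h1]; field_simp
  have h4 : 2 / (p - 1) = q / 2 := by rw [h1]; field_simp; norm_num
  obtain ⟨e, τ, w, h⟩ := exists_isProfile hq hq1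
  obtain ⟨κ, hκ, hred⟩ := h.exists_reduced_posDef hq hq1
  have he := h.smooth_e
  have ht := h.smooth_t
  have hw := h.smooth_w
  have cE : ContDiff ℝ (⊤ : ℕ∞) (profE q e) := by unfold profE; fun_prop
  have cT : ContDiff ℝ (⊤ : ℕ∞) (profT q τ) := by unfold profT; fun_prop
  have cV : ContDiff ℝ (⊤ : ℕ∞) (profV w) := by unfold profV; fun_prop
  have cM := contDiff_mass hκ
  have cB := contDiff_massBox hκ q
  have cTT : ContDiff ℝ (⊤ : ℕ∞) (profTT q κ e w) := by unfold profTT; fun_prop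
  have cRR : ContDiff ℝ (⊤ : ℕ∞) (profRR q κ e w) := by unfold profRR; fun_prop
  have cρ := contDiff_quotTT (q := q) hκ he hw
  have nE : ∀ x, profE q e (-x) = profE q e x := fun x => by
    simp only [profE, h.even_e]; ring
  have nV : ∀ x, profV w (-x) = profV w x := fun x => by
    simp only [profV, h.even_w]; ring
  rw [h2, h4, hqp, h3, h1]
  refine ⟨homExt (2 - q) (mass κ), homExt (-q) (profTT q κ e w), homExt (-q) (profRR q κ e w),
    homExt (-q) (profT q τ), smoothOnCone1_homExt cM, smoothOnCone1_homExt cTT,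
    smoothOnCone1_homExt cRR, smoothOnCone1_homExt cT, isEvenR_homExt mass_neg,
    isEvenR_homExt fun x => by simp only [profTT, nE, nV, massBox_neg],
    isEvenR_homExt fun x => by simp only [profRR, nE, nV, massBox_neg],
    isOddR_homExt fun x => by simp only [profT, h.even_t]; ring,
    homogOrder_homExt _ _, homogOrder_homExt _ _, homogOrder_homExt _ _, homogOrder_homExt _ _,
    vanishOrder_mass hκ q, ?_, vanishOrder_profTR hκ ht, vanishOrder_profRR hκ he hw, ?_, ?_, ?_⟩
  · exact vanishOrder_of_eq (α := -q) cρ fun a _ => by simp only [homExt, profTT_eq hκ]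
  · intro V ePlus hV hE
    have hV' : ∀ a : ℝ × ℝ, 0 < a.1 → V a = homExt (-q) (profV w) a := by
      intro a ha
      rw [hV]
      simp only [pdt_pdt_mass hκ ha, pdr_pdr_mass hκ ha]
      simp only [homExt, profTT, profRR, massBox]
      field_simp
      ring
    have hE' : ∀ a : ℝ × ℝ, 0 < a.1 →
        ePlus a = homExt (-q) (fun x => profE q e x + profT q τ x) a := by
      intro a _
      rw [hE]
      simp only [homExt, profTT, profRR]
      ring
    refine ⟨fun a ha => ?_, fun a ha hr => ?_⟩
    · rw [hV' a ha.1]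
      have hx : |a.2 / a.1| ≤ 1 := by
        rw [abs_div, abs_of_pos ha.1, div_le_one ha.1]; exact ha.2
      have := h.w_nonneg _ hx
      have := Real.rpow_pos_of_pos ha.1 (-q)
      unfold homExt profV
      positivity
    · rw [pdt_congr hE' ha.1, pdr_congr hE' ha.1, pdt_congr hV' ha.1, pdr_congr hV' ha.1,
        hV' a ha.1]
      exact h.transport ha.1 hr
  · intro a ha hr
    have hx : |a.2 / a.1| ≤ 1 := by
      rw [abs_div, abs_of_pos ha.1, div_le_one ha.1]; exact ha.2
    obtain ⟨hP, hQ⟩ := hred _ hx (div_ne_zero hr ha.1.ne')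
    exact IsProfile.posDef_mat3 hκ ha.1 hr hP hQ
  · have hM2 : pdr (pdr (homExt (2 - q) (mass κ))) (1, 0) = 4 := by
      rw [pdr_pdr_mass hκ (by simp)]
      simp [homExt, massDeriv₂]
    have hT2 : pdr (pdr (homExt (-q) (profTT q κ e w))) (1, 0) = 2 * quotTT q κ e w 0 := by
      rw [pdr_congr (fun b hb => pdr_homExt cTT.differentiable_top hb) (by simp),
        pdr_homExt cTT.deriv_top.differentiable_top (by simp), funext (profTT_eq hκ e w)]
      simp [homExt, deriv_deriv_sq_mul cρ]
    rw [hM2, hT2]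
    refine ⟨?_, by norm_num⟩
    simp only [quotTT]
    norm_num
    nlinarith
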